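/- arXiv:math/0603561 — 5 statements merged into one kernel-verified Lean document; each statement's English description precedes it below -/
import Mathlib

section
/- For n ≥ 3, the pair (min{S_1^n, S_2^n}, min{S_3^n, S_4^n}) of minima of two disjoint pairs of spacings is equal in distribution to (S_1^n/2, S_2^n/2). -/
open MeasureTheory

/-- The law of `n` i.i.d. uniform points on `(0,1)`. -/
noncomputable def unif (n : ℕ) : Measure (Fin n → ℝ) :=
  Measure.pi fun _ => volume.restrict (Set.Ioo (0:ℝ) 1)

/-- Order statistics of a tuple of reals. -/
noncomputable def ostat {n : ℕ} (u : Fin n → ℝ) : Fin n → ℝ :=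
  u ∘ Tuple.sort u

/-- The spacings: `spacing u j` is the paper's `S_{j+1}^n`, i.e. `U_{(j+1)} - U_{(j)}`
with boundary conventions `U_{(0)} = 0`, `U_{(n+1)} = 1`. -/
noncomputable def spacing {n : ℕ} (u : Fin n → ℝ) (j : Fin (n+1)) : ℝ :=
  (if h : (j : ℕ) < n then ostat u ⟨j, h⟩ else 1) -
  (if h : 0 < (j : ℕ) then ostat u ⟨(j : ℕ) - 1, by have := j.isLt; omega⟩ else 0)

namespace Spac

/-- Extended order statistics: `0, x_0, ..., x_{n-1}, 1`. -/
noncomputable def ext {n : ℕ} (x : Fin n → ℝ) (k : ℕ) : ℝ :=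
  if k = 0 then 0 else if h : k - 1 < n then x ⟨k - 1, h⟩ else 1

/-- The open ordered simplex. -/
def C (n : ℕ) : Set (Fin n → ℝ) := {x | ∀ k, k ≤ n → ext x k < ext x (k + 1)}

lemma ext_zero {n : ℕ} (x : Fin n → ℝ) : ext x 0 = 0 := by simp [ext]

lemma ext_succ {n : ℕ} (x : Fin n → ℝ) (i : Fin n) : ext x (i + 1) = x i := by
  simp [ext]

lemma ext_last {n : ℕ} (x : Fin n → ℝ) : ext x (n + 1) = 1 := by
  simp [ext]

lemma ext_update {n : ℕ} (x : Fin n → ℝ) (i : Fin n) (t : ℝ) (k : ℕ) :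
    ext (Function.update x i t) k = if k = i + 1 then t else ext x k := by
  unfold ext
  rcases k with _ | k
  · simp
  · by_cases h : k < n
    · simp [h, Function.update_apply, Fin.ext_iff]
    · have : k ≠ i := by have := i.isLt; omega
      simp [h, this]

lemma measurable_ext {n : ℕ} (k : ℕ) : Measurable (fun x : Fin n → ℝ => ext x k) := by
  unfold ext
  split_ifs <;> fun_prop

lemma measurableSet_C (n : ℕ) : MeasurableSet (C n) := by
  have : C n = ⋂ k, ⋂ (_ : k ≤ n), {x | ext x k < ext x (k + 1)} := by
    ext x; simp [C]
  rw [this]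
  exact MeasurableSet.iInter fun k => MeasurableSet.iInter fun _ =>
    measurableSet_lt (measurable_ext k) (measurable_ext (k + 1))

lemma C_lt {n : ℕ} {x : Fin n → ℝ} (hx : x ∈ C n) {k l : ℕ} (hkl : k < l) (hl : l ≤ n + 1) :
    ext x k < ext x l := by
  induction l, hkl using Nat.le_induction with
  | base => exact hx k (by omega)
  | succ l h ih => exact (ih (by omega)).trans (hx l (by omega))

lemma C_strictMono {n : ℕ} {x : Fin n → ℝ} (hx : x ∈ C n) : StrictMono x := by
  intro i j hij
  rw [← ext_succ x i, ← ext_succ x j]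
  exact C_lt hx (by have : (i : ℕ) < j := hij; omega) (by have := j.isLt; omega)

lemma C_mem {n : ℕ} {x : Fin n → ℝ} (hx : x ∈ C n) (i : Fin n) : x i ∈ Set.Ioo (0:ℝ) 1 := by
  have := i.isLt
  constructor
  · rw [← ext_succ x i, ← ext_zero x]
    exact C_lt hx (by omega) (by omega)
  · rw [← ext_succ x i, ← ext_last x]
    exact C_lt hx (by omega) (by omega)

lemma mem_C {n : ℕ} (hn : 0 < n) {x : Fin n → ℝ} (hx : StrictMono x)
    (h : ∀ i, x i ∈ Set.Ioo (0:ℝ) 1) : x ∈ C n := by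
  intro k hk
  rcases k with _ | k
  · rw [ext_zero]
    have := ext_succ x ⟨0, hn⟩
    simp only at this
    rw [this]; exact (h _).1
  · have h1 := ext_succ x ⟨k, by omega⟩
    simp only at h1
    rw [h1]
    rcases Nat.lt_or_ge (k + 1) n with h2 | h2
    · have h3 := ext_succ x ⟨k + 1, h2⟩
      simp only at h3
      rw [h3]
      exact hx (by simp)
    · have : k + 1 = n := by omega
      subst this
      rw [ext_last]
      exact (h _).2

lemma update_mem_C {n : ℕ} {x : Fin n → ℝ} (hx : x ∈ C n) (i : Fin n) (t : ℝ) :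
    Function.update x i t ∈ C n ↔ t ∈ Set.Ioo (ext x i) (ext x (i + 2)) := by
  have hi := i.isLt
  constructor
  · intro h
    have h1 := h i (by omega)
    have h2 := h (i + 1) (by omega)
    simp only [ext_update] at h1 h2
    simp at h1 h2
    exact ⟨h1, h2⟩
  · rintro ⟨h1, h2⟩ k hk
    simp only [ext_update]
    have h0 := hx k hk
    split_ifs with a b b
    · omega
    · subst a; exact h2
    · have : k = i := by omega
      subst this; exact h1
    · exact h0

/-- Modification of one coordinate inside the gap of its neighbours. -/
noncomputable def T {n : ℕ} (ψ : ℝ → ℝ → ℝ → ℝ) (i : Fin n) (x : Fin n → ℝ) : Fin n → ℝ :=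
  Function.update x i (ψ (ext x i) (ext x (i + 2)) (x i))

lemma T_update {n : ℕ} (ψ : ℝ → ℝ → ℝ → ℝ) (i : Fin n) (x : Fin n → ℝ) (t : ℝ) :
    T ψ i (Function.update x i t) = Function.update x i (ψ (ext x i) (ext x (i + 2)) t) := by
  simp [T, ext_update]

lemma T_mp {n : ℕ} (ψ : ℝ → ℝ → ℝ → ℝ) (i : Fin n)
    (hm : Measurable (fun p : ℝ × ℝ × ℝ => ψ p.1 p.2.1 p.2.2))
    (hψ : ∀ a b, Measure.map (ψ a b) (volume.restrict (Set.Ioo a b))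
      = volume.restrict (Set.Ioo a b)) :
    MeasurePreserving (T ψ i) (volume.restrict (C n)) (volume.restrict (C n)) := by
  have hT : Measurable (T ψ i) := by
    unfold T
    refine measurable_pi_iff.2 fun j => ?_
    simp only [Function.update_apply]
    split_ifs
    · exact hm.comp ((measurable_ext (i : ℕ)).prodMk
        ((measurable_ext ((i : ℕ) + 2)).prodMk (measurable_pi_apply i)))
    · fun_prop
  refine ⟨hT, Measure.ext_of_lintegral _ fun f hf => ?_⟩
  rw [lintegral_map hf hT, ← lintegral_indicator (measurableSet_C n),
    ← lintegral_indicator (measurableSet_C n), volume_pi]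
  refine lintegral_eq_of_lmarginal_eq {i} ((hf.comp hT).indicator (measurableSet_C n))
    (hf.indicator (measurableSet_C n)) ?_
  rw [lmarginal_singleton, lmarginal_singleton]
  funext x
  by_cases hx : ∃ t0, Function.update x i t0 ∈ C n
  · obtain ⟨t0, ht0⟩ := hx
    set y := Function.update x i t0 with hy
    have hu : ∀ t, Function.update x i t = Function.update y i t := fun t => by simp [hy]
    simp only [hu]
    have hc : ∀ g : (Fin n → ℝ) → ENNReal, ∀ t, (C n).indicator g (Function.update y i t)
        = (Set.Ioo (ext y i) (ext y (i + 2))).indicator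
          (fun t => g (Function.update y i t)) t := by
      intro g t
      by_cases h : t ∈ Set.Ioo (ext y i) (ext y (i + 2))
      · rw [Set.indicator_of_mem h, Set.indicator_of_mem ((update_mem_C ht0 i t).2 h)]
      · rw [Set.indicator_of_notMem h,
          Set.indicator_of_notMem (fun h' => h ((update_mem_C ht0 i t).1 h'))]
    simp only [hc]
    rw [lintegral_indicator measurableSet_Ioo, lintegral_indicator measurableSet_Ioo]
    simp only [T_update]
    have hg : Measurable fun t => f (Function.update y i t) := hf.comp (measurable_update y)
    have hψm : Measurable (ψ (ext y i) (ext y (i + 2))) :=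
      hm.comp (measurable_const.prodMk (measurable_const.prodMk measurable_id))
    conv_rhs => rw [← hψ]
    rw [lintegral_map hg hψm]
  · push Not at hx
    simp [Set.indicator_of_notMem (hx _)]

/-- tent map -/
noncomputable def tent (a b t : ℝ) : ℝ := a + 2 * min (t - a) (b - t)

/-- reflection -/
noncomputable def refl (a b t : ℝ) : ℝ := a + b - t

lemma meas_tent : Measurable (fun p : ℝ × ℝ × ℝ => tent p.1 p.2.1 p.2.2) := by
  unfold tent; fun_prop

lemma meas_refl : Measurable (fun p : ℝ × ℝ × ℝ => refl p.1 p.2.1 p.2.2) := by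
  unfold refl; fun_prop

lemma map_aux (ψ : ℝ → ℝ) (a b : ℝ) (hm : Measurable ψ)
    (h1 : ∀ t ∈ Set.Ioo a b, a ≤ ψ t)
    (h2 : ∀ c, a < c → volume (ψ ⁻¹' Set.Ici c ∩ Set.Ioo a b) = ENNReal.ofReal (b - c)) :
    Measure.map ψ (volume.restrict (Set.Ioo a b)) = volume.restrict (Set.Ioo a b) := by
  refine Measure.ext_of_Ici _ _ fun c => ?_
  rw [Measure.map_apply hm measurableSet_Ici, Measure.restrict_apply (hm measurableSet_Ici),
    Measure.restrict_apply measurableSet_Ici]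
  rcases le_or_gt c a with h | h
  · congr 1
    ext t
    simp only [Set.mem_inter_iff, Set.mem_preimage, Set.mem_Ici]
    constructor
    · rintro ⟨_, h'⟩; exact ⟨h.trans h'.1.le, h'⟩
    · rintro ⟨_, h'⟩; exact ⟨h.trans (h1 t h'), h'⟩
  · rw [h2 c h]
    have : Set.Ici c ∩ Set.Ioo a b = Set.Ico c b := by
      ext t
      simp only [Set.mem_inter_iff, Set.mem_Ici, Set.mem_Ioo, Set.mem_Ico]
      constructor
      · rintro ⟨h, _, h'⟩; exact ⟨h, h'⟩
      · rintro ⟨h', h''⟩; exact ⟨h', h.trans_le h', h''⟩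
    rw [this, Real.volume_Ico]

lemma map_tent (a b : ℝ) : Measure.map (tent a b) (volume.restrict (Set.Ioo a b))
      = volume.restrict (Set.Ioo a b) := by
  refine map_aux _ a b (by unfold tent; fun_prop) ?_ ?_
  · rintro t ⟨h, h'⟩
    have : 0 ≤ min (t - a) (b - t) := le_min (by linarith) (by linarith)
    unfold tent; linarith
  · intro c hc
    have : tent a b ⁻¹' Set.Ici c ∩ Set.Ioo a b = Set.Icc (a + (c - a) / 2) (b - (c - a) / 2) := by
      ext t
      simp only [Set.mem_inter_iff, Set.mem_preimage, Set.mem_Ici, Set.mem_Ioo, Set.mem_Icc, tent]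
      have : c ≤ a + 2 * min (t - a) (b - t) ↔ (c - a) / 2 ≤ min (t - a) (b - t) := by
        constructor <;> intro h <;> linarith
      rw [this, le_min_iff]
      constructor
      · rintro ⟨⟨h1, h2⟩, h3, h4⟩; constructor <;> linarith
      · rintro ⟨h1, h2⟩; refine ⟨⟨?_, ?_⟩, ?_, ?_⟩ <;> linarith
    rw [this, Real.volume_Icc]
    congr 1; ring

lemma map_refl (a b : ℝ) : Measure.map (refl a b) (volume.restrict (Set.Ioo a b))
      = volume.restrict (Set.Ioo a b) := by
  refine map_aux _ a b (by unfold refl; fun_prop) ?_ ?_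
  · rintro t ⟨h, h'⟩
    unfold refl; linarith
  · intro c hc
    have : refl a b ⁻¹' Set.Ici c ∩ Set.Ioo a b = Set.Ioc a (a + b - c) := by
      ext t
      simp only [Set.mem_inter_iff, Set.mem_preimage, Set.mem_Ici, Set.mem_Ioo, Set.mem_Ioc, refl]
      constructor
      · rintro ⟨h1, h3, h4⟩; constructor <;> linarith
      · rintro ⟨h1, h2⟩; refine ⟨?_, ?_, ?_⟩ <;> linarith
    rw [this, Real.volume_Ioc]
    congr 1; ring

lemma ae_inj (n : ℕ) : ∀ᵐ u ∂(volume : Measure (Fin n → ℝ)), Function.Injective u := by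
  have h : ∀ i j : Fin n, ∀ᵐ u ∂(volume : Measure (Fin n → ℝ)), i ≠ j → u i ≠ u j := by
    intro i j
    by_cases hij : i = j
    · simp [hij]
    · let S : Submodule ℝ (Fin n → ℝ) :=
        LinearMap.ker (LinearMap.proj (R := ℝ) (φ := fun _ : Fin n => ℝ) i - LinearMap.proj j)
      have hS : S ≠ ⊤ := by
        intro h
        have : (Pi.single i 1 : Fin n → ℝ) ∈ S := h ▸ Submodule.mem_top
        simp [S, Ne.symm hij] at this
      have h0 := Measure.addHaar_submodule volume S hS
      filter_upwards [measure_eq_zero_iff_ae_notMem.1 h0] with u hu _ he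
      exact hu (by simp [S, he])
  have h2 : ∀ᵐ u ∂(volume : Measure (Fin n → ℝ)), ∀ i j, i ≠ j → u i ≠ u j := by
    rw [ae_all_iff]; intro i; rw [ae_all_iff]; exact h i
  filter_upwards [h2] with u hu i j hij
  by_contra h
  exact hu i j h hij

lemma unif_eq (n : ℕ) : unif n =
    volume.restrict (Set.univ.pi fun _ : Fin n => Set.Ioo (0:ℝ) 1) := by
  rw [unif, volume_pi, Measure.restrict_pi_pi]

/-- Chamber of a permutation. -/
def B {n : ℕ} (σ : Equiv.Perm (Fin n)) : Set (Fin n → ℝ) := {u | u ∘ σ ∈ C n}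

lemma mp_perm {n : ℕ} (σ : Equiv.Perm (Fin n)) :
    MeasurePreserving (fun u : Fin n → ℝ => u ∘ σ) volume volume := by
  have h := volume_measurePreserving_piCongrLeft (fun _ : Fin n => ℝ) σ.symm
  convert h using 1
  funext u i
  have := Equiv.piCongrLeft_apply_apply (fun _ : Fin n => ℝ) σ.symm u (σ i)
  simp only [Equiv.symm_apply_apply] at this
  exact this.symm

lemma mp_B {n : ℕ} (σ : Equiv.Perm (Fin n)) :
    MeasurePreserving (fun u : Fin n → ℝ => u ∘ σ) (volume.restrict (B σ))
      (volume.restrict (C n)) :=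
  (mp_perm σ).restrict_preimage (measurableSet_C n)

lemma measurableSet_B {n : ℕ} (σ : Equiv.Perm (Fin n)) : MeasurableSet (B σ) :=
  (mp_perm σ).measurable (measurableSet_C n)

lemma ostat_B {n : ℕ} {σ : Equiv.Perm (Fin n)} {u : Fin n → ℝ} (hu : u ∈ B σ) :
    ostat u = u ∘ σ :=
  (Tuple.comp_sort_eq_comp_iff_monotone.2 (C_strictMono hu).monotone).symm

lemma unif_sum {n : ℕ} (hn : 0 < n) :
    unif n = Measure.sum fun σ : Equiv.Perm (Fin n) => volume.restrict (B σ) := by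
  rw [← Measure.restrict_iUnion _ measurableSet_B, unif_eq]
  · refine Measure.restrict_congr_set ?_
    filter_upwards [ae_inj n] with u hu
    refine propext ⟨fun h => ?_, fun h => ?_⟩
    · refine Set.mem_iUnion.2 ⟨Tuple.sort u, mem_C hn ?_ fun i => h _ (Set.mem_univ _)⟩
      exact (Tuple.monotone_sort u).strictMono_of_injective
        (hu.comp (Tuple.sort u).injective)
    · obtain ⟨σ, hσ⟩ := Set.mem_iUnion.1 h
      intro i _
      have := C_mem hσ (σ.symm i)
      simpa using this
  · intro σ τ hst
    refine Set.disjoint_left.2 fun u h1 h2 => hst ?_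
    have h3 : u ∘ σ = u ∘ τ := (ostat_B h1).symm.trans (ostat_B h2)
    have hinj : Function.Injective u := by
      have := (C_strictMono h1).injective.comp σ.symm.injective
      simpa [Function.comp_assoc] using this
    ext i
    exact congrArg Fin.val (hinj (congrFun h3 i))

lemma transfer {n : ℕ} (hn : 0 < n) {F : (Fin n → ℝ) → ℝ × ℝ} (hF : Measurable F) :
    Measure.map (fun u => F (ostat u)) (unif n)
      = Measure.sum fun _ : Equiv.Perm (Fin n) => Measure.map F (volume.restrict (C n)) := by
  have hae : ∀ σ : Equiv.Perm (Fin n),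
      (fun u => F (ostat u)) =ᵐ[volume.restrict (B σ)] (fun u => F (u ∘ σ)) := by
    intro σ
    filter_upwards [ae_restrict_mem (measurableSet_B σ)] with u hu
    rw [ostat_B hu]
  have hmeas : ∀ σ : Equiv.Perm (Fin n), Measurable (fun u : Fin n → ℝ => F (u ∘ σ)) :=
    fun σ => hF.comp (mp_perm σ).measurable
  rw [unif_sum hn, Measure.map_sum]
  · congr 1
    funext σ
    rw [Measure.map_congr (hae σ), ← (mp_B σ).map_eq, Measure.map_map hF (mp_B σ).measurable]
    rfl
  · exact AEMeasurable.sum_measure fun σ => ⟨_, hmeas σ, hae σ⟩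

lemma spacing_eq {n : ℕ} (u : Fin n → ℝ) (j : Fin (n + 1)) (k : ℕ) (hk : (j : ℕ) = k) :
    spacing u j = ext (ostat u) (k + 1) - ext (ostat u) k := by
  subst hk
  unfold spacing ext
  by_cases h : (j : ℕ) = 0
  · simp [h]
  · have h1 : (j : ℕ) - 1 < n := by have := j.isLt; omega
    simp [h, h1, Nat.pos_of_ne_zero h]

end Spac

open Spac in
/-- The pair of minima of two disjoint pairs of uniform spacings is equal in distribution
to `(S₁ⁿ/2, S₂ⁿ/2)`. -/
theorem min_pairs_spacings (n : ℕ) (hn : 3 ≤ n) :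
    Measure.map (fun u => (min (spacing u 0) (spacing u 1),
        min (spacing u 2) (spacing u 3))) (unif n)
      = Measure.map (fun u => (spacing u 0 / 2, spacing u 1 / 2)) (unif n) := by
  have e0 : ∀ u : Fin n → ℝ, _ := fun u => spacing_eq u 0 0 (by simp)
  have e1 : ∀ u : Fin n → ℝ, _ := fun u => spacing_eq u 1 1
    (by exact Nat.mod_eq_of_lt (by omega : 1 < n + 1))
  have e2 : ∀ u : Fin n → ℝ, _ := fun u => spacing_eq u 2 2
    (by exact Nat.mod_eq_of_lt (by omega : 2 < n + 1))
  have e3 : ∀ u : Fin n → ℝ, _ := fun u => spacing_eq u 3 3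
    (by exact Nat.mod_eq_of_lt (by omega : 3 < n + 1))
  simp only [e0, e1, e2, e3]
  have me := fun k => measurable_ext (n := n) k
  let L : (Fin n → ℝ) → ℝ × ℝ := fun x => (min (ext x 1 - ext x 0) (ext x 2 - ext x 1),
    min (ext x 3 - ext x 2) (ext x 4 - ext x 3))
  let G : (Fin n → ℝ) → ℝ × ℝ := fun x => ((ext x 1 - ext x 0) / 2, (ext x 2 - ext x 1) / 2)
  let H : (Fin n → ℝ) → ℝ × ℝ := fun x => ((ext x 1 - ext x 0) / 2, (ext x 3 - ext x 2) / 2)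
  have hL : Measurable L := (((me 1).sub (me 0)).min ((me 2).sub (me 1))).prodMk
    (((me 3).sub (me 2)).min ((me 4).sub (me 3)))
  have hG : Measurable G := (((me 1).sub (me 0)).div_const 2).prodMk
    (((me 2).sub (me 1)).div_const 2)
  have hH : Measurable H := (((me 1).sub (me 0)).div_const 2).prodMk
    (((me 3).sub (me 2)).div_const 2)
  let i0 : Fin n := ⟨0, by omega⟩
  let i1 : Fin n := ⟨1, by omega⟩
  let i2 : Fin n := ⟨2, by omega⟩
  have t0 := T_mp tent i0 meas_tent map_tent
  have t2 := T_mp tent i2 meas_tent map_tent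
  have r1 := T_mp refl i1 meas_refl map_refl
  have s0 : ∀ (x : Fin n → ℝ) (h : 0 < n), x ⟨0, h⟩ = ext x 1 :=
    fun x h => (ext_succ x ⟨0, h⟩).symm
  have s1 : ∀ (x : Fin n → ℝ) (h : 1 < n), x ⟨1, h⟩ = ext x 2 :=
    fun x h => (ext_succ x ⟨1, h⟩).symm
  have s2 : ∀ (x : Fin n → ℝ) (h : 2 < n), x ⟨2, h⟩ = ext x 3 :=
    fun x h => (ext_succ x ⟨2, h⟩).symm
  have hHL : H ∘ T tent i0 ∘ T tent i2 = L := by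
    funext x
    simp only [Function.comp, H, L, T, ext_update]
    simp [i0, i2, ext_zero, tent, s0, s2, ext_update]
  have hGH : G ∘ T refl i1 = H := by
    funext x
    simp only [Function.comp, H, G, T, ext_update]
    simp [i1, Spac.refl, s1]
    ring
  have key : Measure.map L (volume.restrict (C n)) = Measure.map G (volume.restrict (C n)) := by
    rw [← hHL, ← Measure.map_map hH (t0.measurable.comp t2.measurable), (t0.comp t2).map_eq,
      ← hGH, ← Measure.map_map hG r1.measurable, r1.map_eq]
  have hpos : 0 < n := by omega
  exact (transfer hpos hL).trans ((by rw [key]) : _ = _) |>.trans (transfer hpos hG).symm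
end

section
/- For α > 1, the expected total α-power-weighted length of the ONG on (0, 1, U_1, ..., U_n) equals 1 + 2^{-α}/(α-1) - 2^{-α}Γ(1+α)Γ(n+2)/((α-1)Γ(n+1+α)), which converges to 1 + 2^{-α}/(α-1) as n → ∞. -/
open MeasureTheory

/-- Total `α`-power-weighted length of the on-line nearest-neighbour graph on the
sequence of points `x 0, x 1, …`: each point after the first is joined to its nearest
neighbour among the points preceding it in the sequence. -/
noncomputable def ongWeight (α : ℝ) {m : ℕ} (x : Fin m → ℝ) : ℝ :=
  ∑ i : Fin m, if 0 < (i : ℕ) then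
      (sInf {d : ℝ | ∃ j : Fin m, (j : ℕ) < (i : ℕ) ∧ d = |x i - x j|}) ^ α
    else 0

/-- distance from `x` to its nearest neighbour among `w`. -/
noncomputable def nnDist {m : ℕ} (w : Fin m → ℝ) (x : ℝ) : ℝ :=
  sInf {d : ℝ | ∃ j : Fin m, d = |x - w j|}

lemma ongWeight_snoc (α : ℝ) {m : ℕ} (hm : 0 < m) (w : Fin m → ℝ) (x : ℝ) :
    ongWeight α (Fin.snoc w x : Fin (m+1) → ℝ) = ongWeight α w + nnDist w x ^ α := by
  unfold ongWeight nnDist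
  rw [Fin.sum_univ_castSucc]
  congr 1
  · refine Finset.sum_congr rfl fun i _ => ?_
    simp only [Fin.val_castSucc, Fin.snoc_castSucc]
    congr 3
    ext d
    simp only [Set.mem_ofPred_eq]
    constructor
    · rintro ⟨j, hj, rfl⟩
      refine ⟨⟨j, hj.trans i.2⟩, hj, ?_⟩
      exact congrArg (fun y => |w i - y|)
        (Fin.snoc_castSucc (α := fun _ => ℝ) x w ⟨j, hj.trans i.2⟩)
    · rintro ⟨j, hj, rfl⟩
      exact ⟨j.castSucc, hj, by rw [Fin.snoc_castSucc]⟩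
  · simp only [Fin.val_last, hm, if_true, Fin.snoc_last]
    congr 2
    ext d
    simp only [Set.mem_ofPred_eq]
    constructor
    · rintro ⟨j, hj, rfl⟩
      refine ⟨⟨j, hj⟩, ?_⟩
      exact congrArg (fun y => |x - y|) (Fin.snoc_castSucc (α := fun _ => ℝ) x w ⟨j, hj⟩)
    · rintro ⟨j, rfl⟩
      exact ⟨j.castSucc, j.2, by rw [Fin.snoc_castSucc]⟩

lemma lt_nnDist_iff {m : ℕ} (hm : 0 < m) (w : Fin m → ℝ) (x t : ℝ) :
    t < nnDist w x ↔ ∀ j, t < |x - w j| := by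
  unfold nnDist
  have h : {d : ℝ | ∃ j : Fin m, d = |x - w j|} = Set.range fun j => |x - w j| := by
    ext d; simp [eq_comm]
  rw [h, Set.Finite.lt_csInf_iff (Set.finite_range _) ⟨_, ⟨⟨0, hm⟩, rfl⟩⟩]
  simp

/-- nearest neighbour distance with the endpoints included. -/
noncomputable def T {n : ℕ} (p : ℝ × (Fin n → ℝ)) : ℝ :=
  nnDist (Fin.cons 0 (Fin.cons 1 p.2) : Fin (n+2) → ℝ) p.1

lemma lt_T_iff {n : ℕ} (p : ℝ × (Fin n → ℝ)) (t : ℝ) :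
    t < T p ↔ t < |p.1| ∧ t < |p.1 - 1| ∧ ∀ j, t < |p.1 - p.2 j| := by
  unfold T
  rw [lt_nnDist_iff (by omega), Fin.forall_fin_succ, Fin.forall_fin_succ]
  simp

lemma T_nonneg {n : ℕ} (p : ℝ × (Fin n → ℝ)) : 0 ≤ T p := by
  unfold T nnDist
  apply Real.sInf_nonneg
  rintro _ ⟨j, rfl⟩
  positivity

lemma T_le {n : ℕ} (p : ℝ × (Fin n → ℝ)) : T p ≤ |p.1| := by
  by_contra! h
  exact absurd ((lt_T_iff p _).1 h).1 (lt_irrefl _)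

lemma measurable_T {n : ℕ} : Measurable (T : ℝ × (Fin n → ℝ) → ℝ) := by
  refine measurable_of_Ioi fun t => ?_
  have : T ⁻¹' Set.Ioi t = {p : ℝ × (Fin n → ℝ) | t < |p.1|} ∩ ({p | t < |p.1 - 1|} ∩
      ⋂ j, {p | t < |p.1 - p.2 j|}) := by
    ext p
    simp [lt_T_iff]
  rw [this]
  refine (measurableSet_lt (by fun_prop) (by fun_prop)).inter
    ((measurableSet_lt (by fun_prop) (by fun_prop)).inter
    (MeasurableSet.iInter fun j => measurableSet_lt (by fun_prop) (by fun_prop)))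

instance : IsProbabilityMeasure (volume.restrict (Set.Ioo (0:ℝ) 1)) :=
  ⟨by simp⟩

instance (n : ℕ) : IsProbabilityMeasure (unif n) := by
  unfold unif; infer_instance

lemma slice_meas {x t : ℝ} (ht : 0 < t) (h1 : t < x) (h2 : x < 1 - t) :
    volume.restrict (Set.Ioo (0:ℝ) 1) {y | t < |x - y|} = ENNReal.ofReal (1 - 2 * t) := by
  rw [Measure.restrict_apply (measurableSet_lt (by fun_prop) (by fun_prop))]
  have : {y | t < |x - y|} ∩ Set.Ioo (0:ℝ) 1 = Set.Ioo 0 (x - t) ∪ Set.Ioo (x + t) 1 := by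
    ext y
    simp only [Set.mem_inter_iff, Set.mem_ofPred_eq, Set.mem_Ioo, Set.mem_union, lt_abs]
    constructor
    · rintro ⟨h | h, h3, h4⟩
      · left; constructor <;> linarith
      · right; constructor <;> linarith
    · rintro (⟨h, h'⟩ | ⟨h, h'⟩)
      · exact ⟨Or.inl (by linarith), by linarith, by linarith⟩
      · exact ⟨Or.inr (by linarith), by linarith, by linarith⟩
  rw [this, measure_union _ measurableSet_Ioo, Real.volume_Ioo, Real.volume_Ioo,
    ← ENNReal.ofReal_add (by linarith) (by linarith)]
  · congr 1; ring
  · rw [Set.disjoint_left]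
    rintro y ⟨_, h⟩ ⟨h', _⟩
    linarith

lemma tail_T (n : ℕ) {t : ℝ} (ht : 0 < t) :
    ((volume.restrict (Set.Ioo (0:ℝ) 1)).prod (unif n)) {p | t < T p}
      = ENNReal.ofReal (1 - 2 * t) ^ (n + 1) := by
  rw [Measure.prod_apply (measurableSet_lt measurable_const measurable_T)]
  have h : ∀ x ∈ Set.Ioo (0:ℝ) 1, unif n (Prod.mk x ⁻¹' {p | t < T p}) =
      (Set.Ioo t (1 - t)).indicator (fun _ => ENNReal.ofReal (1 - 2 * t) ^ n) x := by
    intro x hx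
    by_cases hxt : x ∈ Set.Ioo t (1 - t)
    · rw [Set.indicator_of_mem hxt]
      have : (Prod.mk x ⁻¹' {p : ℝ × (Fin n → ℝ) | t < T p}) =
          Set.pi Set.univ fun _ => {y | t < |x - y|} := by
        ext v
        have h1 : t < |x| := hxt.1.trans_le (le_abs_self x)
        have h2 : t < |x - 1| := lt_abs.2 (Or.inr (by linarith [hxt.2]))
        simp [lt_T_iff, h1, h2]
      rw [this, unif, Measure.pi_pi]
      simp [slice_meas ht hxt.1 hxt.2]
    · rw [Set.indicator_of_notMem hxt]
      have : (Prod.mk x ⁻¹' {p : ℝ × (Fin n → ℝ) | t < T p}) = ∅ := by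
        ext v
        simp only [Set.mem_preimage, Set.mem_ofPred_eq, lt_T_iff, Set.mem_empty_iff_false, iff_false]
        rintro ⟨h1, h2, -⟩
        rw [abs_of_pos hx.1] at h1
        rw [abs_of_neg (by linarith [hx.2])] at h2
        exact hxt ⟨h1, by linarith⟩
      rw [this, measure_empty]
  rw [setLIntegral_congr_fun measurableSet_Ioo h, lintegral_indicator measurableSet_Ioo,
    lintegral_const, Measure.restrict_apply_univ, Measure.restrict_apply measurableSet_Ioo,
    Set.inter_eq_left.2 (Set.Ioo_subset_Ioo ht.le (by linarith)), Real.volume_Ioo, pow_succ]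
  congr 2
  ring

lemma lintegral_scale (f : ℝ → ENNReal) (hf : Measurable f) :
    ∫⁻ t, f (2 * t) = ENNReal.ofReal (1/2) * ∫⁻ t, f t := by
  rw [← lintegral_map (μ := volume) hf (measurable_const_mul (2:ℝ)),
    Real.map_volume_mul_left (by norm_num), lintegral_smul_measure, smul_eq_mul]
  congr 2
  norm_num

lemma beta_lint (α : ℝ) (hα : 1 < α) (n : ℕ) :
    ∫⁻ t in Set.Ioi (0:ℝ), ENNReal.ofReal (1 - 2 * t) ^ (n + 1) * ENNReal.ofReal (t ^ (α - 1))
      = ENNReal.ofReal (2 ^ (-α) * ProbabilityTheory.beta α (n + 2)) := by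
  have hb : 0 < ProbabilityTheory.beta α (n + 2) :=
    ProbabilityTheory.beta_pos (by linarith) (by positivity)
  have h : ∀ t ∈ Set.Ioi (0:ℝ),
      ENNReal.ofReal (1 - 2 * t) ^ (n + 1) * ENNReal.ofReal (t ^ (α - 1)) =
      ENNReal.ofReal (2 ^ (1 - α) * ProbabilityTheory.beta α (n + 2)) *
        ProbabilityTheory.betaPDF α (n + 2) (2 * t) := by
    intro t ht
    have ht : 0 < t := ht
    by_cases h1 : 2 * t < 1
    · rw [ProbabilityTheory.betaPDF_of_pos_lt_one (by linarith) h1,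
        ← ENNReal.ofReal_pow (by linarith), ← ENNReal.ofReal_mul (pow_nonneg (by linarith) _),
        ← ENNReal.ofReal_mul (by positivity)]
      congr 1
      rw [Real.mul_rpow (by norm_num) ht.le, show (n:ℝ) + 2 - 1 = ((n + 1 : ℕ) : ℝ) by
        push_cast; ring, Real.rpow_natCast]
      have : (2:ℝ) ^ (1 - α) * 2 ^ (α - 1) = 1 := by
        rw [← Real.rpow_add (by norm_num)]; simp
      field_simp
      linear_combination (-(1 - 2 * t) ^ (n + 1)) * this
    · rw [ProbabilityTheory.betaPDF_eq_zero_of_one_le (by linarith),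
        ENNReal.ofReal_of_nonpos (by linarith)]
      simp
  have hm : Measurable (ProbabilityTheory.betaPDF α (n + 2)) :=
    (ProbabilityTheory.measurable_betaPDFReal _ _).ennreal_ofReal
  rw [setLIntegral_congr_fun measurableSet_Ioi h, lintegral_const_mul _ (by fun_prop),
    setLIntegral_eq_of_support_subset, lintegral_scale _ hm,
    ProbabilityTheory.lintegral_betaPDF_eq_one (by linarith) (by positivity), mul_one,
    ← ENNReal.ofReal_mul (by positivity)]
  · congr 1
    rw [sub_eq_add_neg, Real.rpow_add (by norm_num), Real.rpow_one]
    ring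
  · intro t ht
    by_contra h0
    exact ht (ProbabilityTheory.betaPDF_eq_zero_of_nonpos (by simp at h0; linarith))

lemma integral_T (α : ℝ) (hα : 1 < α) (n : ℕ) :
    ∫ p, T p ^ α ∂((volume.restrict (Set.Ioo (0:ℝ) 1)).prod (unif n)) =
      α * (2 ^ (-α) * ProbabilityTheory.beta α (n + 2)) := by
  have hb : 0 < ProbabilityTheory.beta α (n + 2) :=
    ProbabilityTheory.beta_pos (by linarith) (by positivity)
  rw [integral_eq_lintegral_of_nonneg_ae
    (Filter.Eventually.of_forall fun p => Real.rpow_nonneg (T_nonneg p) _)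
    (measurable_T.pow_const α).aestronglyMeasurable,
    lintegral_rpow_eq_lintegral_meas_lt_mul _ (Filter.Eventually.of_forall T_nonneg)
      measurable_T.aemeasurable (by linarith),
    setLIntegral_congr_fun measurableSet_Ioi
      (fun t ht => by rw [tail_T n ht]), beta_lint α hα n, ← ENNReal.ofReal_mul (by linarith),
    ENNReal.toReal_ofReal (by positivity)]

lemma integrable_T (α : ℝ) (hα : 1 < α) (n : ℕ) :
    Integrable (fun p : ℝ × (Fin n → ℝ) => T p ^ α)
      ((volume.restrict (Set.Ioo (0:ℝ) 1)).prod (unif n)) := by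
  refine Integrable.of_bound (measurable_T.pow_const α).aestronglyMeasurable 1 ?_
  have : ∀ᵐ p ∂((volume.restrict (Set.Ioo (0:ℝ) 1)).prod (unif n)), p.1 ∈ Set.Ioo (0:ℝ) 1 :=
    Measure.quasiMeasurePreserving_fst.ae (ae_restrict_mem measurableSet_Ioo)
  filter_upwards [this] with p hp
  rw [Real.norm_of_nonneg (Real.rpow_nonneg (T_nonneg p) _)]
  refine Real.rpow_le_one (T_nonneg p) ((T_le p).trans ?_) (by linarith)
  rw [abs_of_pos hp.1]
  exact hp.2.le

lemma mp (n : ℕ) : MeasurePreserving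
    (fun p : ℝ × (Fin n → ℝ) => (Fin.snoc p.2 p.1 : Fin (n+1) → ℝ))
    ((volume.restrict (Set.Ioo (0:ℝ) 1)).prod (unif n)) (unif (n+1)) := by
  have := (measurePreserving_piFinSuccAbove
    (fun _ : Fin (n+1) => volume.restrict (Set.Ioo (0:ℝ) 1)) (Fin.last n)).symm
  convert this using 1
  · ext p
    simp [MeasurableEquiv.piFinSuccAbove]
  · rfl
  · rfl

lemma weight_snoc (α : ℝ) {n : ℕ} (p : ℝ × (Fin n → ℝ)) :
    ongWeight α (Fin.cons 0 (Fin.cons 1 (Fin.snoc p.2 p.1 : Fin (n+1) → ℝ)) : Fin (n+3) → ℝ) =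
      ongWeight α (Fin.cons 0 (Fin.cons 1 p.2) : Fin (n+2) → ℝ) + T p ^ α := by
  rw [Fin.cons_snoc_eq_snoc_cons, Fin.cons_snoc_eq_snoc_cons, ongWeight_snoc α (by omega)]
  rfl

lemma mpEmb (n : ℕ) : MeasurableEmbedding
    (fun p : ℝ × (Fin n → ℝ) => (Fin.snoc p.2 p.1 : Fin (n+1) → ℝ)) := by
  have := (MeasurableEquiv.piFinSuccAbove (fun _ : Fin (n+1) => ℝ)
    (Fin.last n)).symm.measurableEmbedding
  convert this using 1
  ext p
  simp [MeasurableEquiv.piFinSuccAbove, Fin.insertNth_last']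

lemma gamma_prod (s : ℝ) (hs : 0 < s) (m : ℕ) :
    (∏ j ∈ Finset.range m, (s + j)) * Real.Gamma s = Real.Gamma (s + m) := by
  induction m with
  | zero => simp
  | succ m ih =>
    rw [Finset.prod_range_succ, mul_right_comm, ih]
    push_cast
    rw [← add_assoc, Real.Gamma_add_one (by positivity), mul_comm]

lemma gamma_lim (α : ℝ) (hα : 1 < α) : Filter.Tendsto
    (fun n : ℕ => Real.Gamma ((n:ℝ)+2) / Real.Gamma ((n:ℝ)+1+α)) Filter.atTop (nhds 0) := by
  have hs : 0 < α - 1 := by linarith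
  have h1 := (Real.GammaSeq_tendsto_Gamma (α - 1)).comp (Filter.tendsto_add_atTop_nat 1)
  have h2 : Filter.Tendsto (fun n : ℕ => (((n + 1 : ℕ) : ℝ)) ^ (-(α - 1))) Filter.atTop (nhds 0) :=
    ((tendsto_rpow_neg_atTop hs).comp tendsto_natCast_atTop_atTop).comp
      (Filter.tendsto_add_atTop_nat 1)
  have h3 := (h1.mul h2).div_const (Real.Gamma (α - 1))
  simp only [mul_zero, zero_div] at h3
  refine h3.congr fun n => ?_
  have hg := Real.Gamma_pos_of_pos hs
  have hp := gamma_prod (α - 1) hs (n + 1 + 1)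
  have e1 : α - 1 + ((n + 1 + 1 : ℕ) : ℝ) = n + 1 + α := by push_cast; ring
  have e2 : Real.Gamma ((n:ℝ) + 2) = ((n + 1).factorial : ℝ) := by
    rw [← Real.Gamma_nat_eq_factorial]; congr 1; push_cast; ring
  have hpos : 0 < ∏ j ∈ Finset.range (n + 1 + 1), (α - 1 + (j:ℝ)) :=
    Finset.prod_pos fun j _ => by positivity
  rw [e1] at hp
  rw [← hp, e2]
  have hx : (0:ℝ) < (((n + 1 : ℕ) : ℝ)) ^ (α - 1) := by positivity
  simp only [Function.comp, Real.GammaSeq]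
  rw [Real.rpow_neg (by positivity)]
  field_simp

lemma ong_main (α : ℝ) (hα : 1 < α) (n : ℕ) :
    Integrable (fun u => ongWeight α (Fin.cons 0 (Fin.cons 1 u) : Fin (n+2) → ℝ)) (unif n) ∧
      ∫ u, ongWeight α (Fin.cons 0 (Fin.cons 1 u)) ∂(unif n)
        = 1 + (2:ℝ)^(-α)/(α-1)
          - (2:ℝ)^(-α) * Real.Gamma (1+α) * Real.Gamma ((n:ℝ)+2)
              / ((α-1) * Real.Gamma ((n:ℝ)+1+α)) := by
  induction n with
  | zero =>
    have h : ∀ u : Fin 0 → ℝ,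
        ongWeight α (Fin.cons 0 (Fin.cons 1 u) : Fin 2 → ℝ) = 1 := by
      intro u
      have : {d : ℝ | ∃ j : Fin 2, (j : ℕ) < 1 ∧
          d = |1 - (Fin.cons 0 (Fin.cons 1 u) : Fin 2 → ℝ) j|} = {1} := by
        ext d
        simp [Fin.exists_fin_two]
      have h1 : (Fin.cons 0 (Fin.cons 1 u) : Fin 2 → ℝ) 1 = 1 := rfl
      simp [ongWeight, Fin.sum_univ_two, h1, this]
    have hg : Real.Gamma (1 + α) ≠ 0 := (Real.Gamma_pos_of_pos (by linarith)).ne'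
    have h2 : Real.Gamma 2 = 1 := by simp
    have h3 : α - 1 ≠ 0 := by linarith
    refine ⟨?_, ?_⟩
    · simp only [h]; exact integrable_const _
    · simp only [h]
      simp [h2]
      field_simp
      ring
  | succ n ih =>
    obtain ⟨ih1, ih2⟩ := ih
    have i1 : Integrable (fun p : ℝ × (Fin n → ℝ) =>
        ongWeight α (Fin.cons 0 (Fin.cons 1 p.2) : Fin (n+2) → ℝ))
        ((volume.restrict (Set.Ioo (0:ℝ) 1)).prod (unif n)) := ih1.comp_snd _
    have i2 := integrable_T α hα n
    refine ⟨?_, ?_⟩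
    · rw [← (mp n).integrable_comp_emb (mpEmb n)]
      exact (i1.add i2).congr (Filter.Eventually.of_forall fun p => (weight_snoc α p).symm)
    · rw [← (mp n).integral_comp (mpEmb n)]
      simp only [weight_snoc]
      rw [integral_add i1 i2, integral_T α hα n,
        integral_fun_snd (μ := volume.restrict (Set.Ioo (0:ℝ) 1)) (ν := unif n)
          (fun u => ongWeight α (Fin.cons 0 (Fin.cons 1 u) : Fin (n+2) → ℝ)), ih2]
      simp only [ProbabilityTheory.beta, probReal_univ, one_smul]
      have g1 : Real.Gamma (1 + α) = α * Real.Gamma α := by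
        rw [add_comm, Real.Gamma_add_one (by linarith)]
      have g2 : Real.Gamma (((n + 1 : ℕ) : ℝ) + 2) = (n + 2) * Real.Gamma (n + 2) := by
        rw [← Real.Gamma_add_one (by positivity)]; congr 1; push_cast; ring
      have g3 : Real.Gamma (((n + 1 : ℕ) : ℝ) + 1 + α) = (n + 1 + α) * Real.Gamma (n + 1 + α) := by
        rw [← Real.Gamma_add_one (by positivity)]; congr 1; push_cast; ring
      have g4 : Real.Gamma (α + (n + 2)) = (n + 1 + α) * Real.Gamma (n + 1 + α) := by
        rw [← Real.Gamma_add_one (by positivity)]; congr 1; ring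
      have g5 : Real.Gamma (n + 1 + α) ≠ 0 := (Real.Gamma_pos_of_pos (by positivity)).ne'
      have g6 : (n:ℝ) + 1 + α ≠ 0 := by positivity
      have h3 : α - 1 ≠ 0 := by linarith
      rw [g1, g2, g3, g4]
      field_simp
      ring

/-- For `α > 1`, the expected total `α`-power-weighted length of the ONG on
`(0, 1, U₁, …, U_n)` equals
`1 + 2^(-α)/(α-1) - 2^(-α)Γ(1+α)Γ(n+2)/((α-1)Γ(n+1+α))`, which converges to
`1 + 2^(-α)/(α-1)` as `n → ∞`. -/
theorem ong_expected_weight_alpha_gt_one (α : ℝ) (hα : 1 < α) :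
    (∀ n : ℕ,
      ∫ u, ongWeight α (Fin.cons 0 (Fin.cons 1 u)) ∂(unif n)
        = 1 + (2:ℝ)^(-α)/(α-1)
          - (2:ℝ)^(-α) * Real.Gamma (1+α) * Real.Gamma ((n:ℝ)+2)
              / ((α-1) * Real.Gamma ((n:ℝ)+1+α)))
    ∧ Filter.Tendsto
        (fun n : ℕ => ∫ u, ongWeight α (Fin.cons 0 (Fin.cons 1 u)) ∂(unif n))
        Filter.atTop (nhds (1 + (2:ℝ)^(-α)/(α-1))) := by
  refine ⟨fun n => (ong_main α hα n).2, ?_⟩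
  simp only [fun n => (ong_main α hα n).2]
  have := ((gamma_lim α hα).const_mul ((2:ℝ)^(-α) * Real.Gamma (1+α) / (α - 1))).const_sub
    (1 + (2:ℝ)^(-α)/(α-1))
  rw [mul_zero, sub_zero] at this
  refine this.congr fun n => ?_
  rw [div_mul_div_comm]
end

section
/- For α > 0 and n ≥ 2, E[ONG weight on (0,U_1,...,U_n)] − E[ONG weight on (0,1,U_1,...,U_n)] = (1-2^{-α}-α)/α + (2^{-α}-1)Γ(α)Γ(n+1)/Γ(n+1+α) = (1-2^{-α}-α)/α + O(n^{-α}). -/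
open MeasureTheory

namespace OngAux

open Set Filter

/-- uniform law on the unit interval -/
noncomputable abbrev nu : Measure ℝ := volume.restrict (Ioo (0:ℝ) 1)

instance : IsProbabilityMeasure nu := ⟨by simp [nu]⟩

instance (n : ℕ) : IsProbabilityMeasure (unif n) := by
  unfold unif
  infer_instance

lemma ae_unif (n : ℕ) : ∀ᵐ u ∂(unif n), ∀ j, u j ∈ Ioo (0:ℝ) 1 := by
  have h : unif n = (volume : Measure (Fin n → ℝ)).restrict (univ.pi fun _ => Ioo (0:ℝ) 1) := by
    rw [volume_pi, Measure.restrict_pi_pi]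
    rfl
  rw [h]
  filter_upwards [ae_restrict_mem (MeasurableSet.univ_pi fun _ => measurableSet_Ioo)] with u hu j
  exact hu j (mem_univ j)

/-- distance from `a` to the nearest point of `x` -/
noncomputable def nd {m : ℕ} (x : Fin m → ℝ) (a : ℝ) : ℝ := ⨅ j, |a - x j|

lemma ong_snoc (α : ℝ) {m : ℕ} (x : Fin (m+1) → ℝ) (a : ℝ) :
    ongWeight α (Fin.snoc x a : Fin (m+1+1) → ℝ) = ongWeight α x + (nd x a)^α := by
  unfold ongWeight
  rw [Fin.sum_univ_castSucc]
  congr 1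
  · refine Finset.sum_congr rfl fun i _ => ?_
    simp only [Fin.val_castSucc]
    congr 3
    ext d
    simp only [mem_ofPred_eq, Fin.exists_fin_succ', Fin.val_castSucc, Fin.snoc_castSucc,
      Fin.val_last]
    constructor
    · rintro (h | ⟨h, _⟩)
      · exact h
      · have := i.2; omega
    · exact Or.inl
  · have : (0:ℕ) < (Fin.last (m+1) : Fin (m+1+1)).val := by simp
    rw [if_pos this]
    congr 1
    unfold nd iInf
    congr 1
    ext d
    constructor
    · rintro ⟨j, hj, h⟩
      induction j using Fin.lastCases with
      | last => exact absurd hj (lt_irrefl _)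
      | cast j =>
        rw [Fin.snoc_castSucc, Fin.snoc_last] at h
        exact ⟨j, h.symm⟩
    · rintro ⟨j, h⟩
      refine ⟨j.castSucc, ?_, ?_⟩
      · simpa using j.2
      · rw [Fin.snoc_castSucc, Fin.snoc_last]
        exact h.symm

/-- `(0, u)` -/
noncomputable def c0 {n : ℕ} (u : Fin n → ℝ) : Fin (n+1) → ℝ := Fin.cons 0 u
/-- `(0, 1, u)` -/
noncomputable def c1 {n : ℕ} (u : Fin n → ℝ) : Fin (n+1+1) → ℝ := Fin.cons 0 (Fin.cons 1 u : Fin (n+1) → ℝ)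

lemma c0_snoc {n : ℕ} (u : Fin n → ℝ) (a : ℝ) :
    c0 (Fin.snoc u a : Fin (n+1) → ℝ) = Fin.snoc (c0 u) a := by
  unfold c0
  rw [Fin.cons_snoc_eq_snoc_cons]

lemma c1_snoc {n : ℕ} (u : Fin n → ℝ) (a : ℝ) :
    c1 (Fin.snoc u a : Fin (n+1) → ℝ) = Fin.snoc (c1 u) a := by
  unfold c1
  rw [Fin.cons_snoc_eq_snoc_cons, Fin.cons_snoc_eq_snoc_cons]

lemma meas_c0 {n : ℕ} : Measurable (c0 : (Fin n → ℝ) → _) := by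
  refine measurable_pi_iff.2 fun i => ?_
  induction i using Fin.cases with
  | zero => simp [c0]
  | succ i => simpa [c0] using measurable_pi_apply i

lemma meas_c1 {n : ℕ} : Measurable (c1 : (Fin n → ℝ) → _) := by
  refine measurable_pi_iff.2 fun i => ?_
  induction i using Fin.cases with
  | zero => simp [c1]
  | succ i =>
    induction i using Fin.cases with
    | zero => simp [c1]
    | succ i => simpa [c1] using measurable_pi_apply i

lemma nd_nonneg {m : ℕ} (x : Fin m → ℝ) (a : ℝ) : 0 ≤ nd x a := Real.iInf_nonneg fun _ => abs_nonneg _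

lemma nd_le {m : ℕ} (x : Fin m → ℝ) (a : ℝ) (j : Fin m) : nd x a ≤ |a - x j| :=
  ciInf_le (Set.finite_range _).bddBelow j

lemma nd_meas {m n : ℕ} {c : (Fin n → ℝ) → Fin m → ℝ} (hc : Measurable c) :
    Measurable fun p : ℝ × (Fin n → ℝ) => nd (c p.2) p.1 := by
  unfold nd
  refine Measurable.iInf fun j => ?_
  have : Measurable fun p : ℝ × (Fin n → ℝ) => c p.2 j :=
    (measurable_pi_apply j).comp (hc.comp measurable_snd)
  exact (measurable_fst.sub this).abs

lemma mp (n : ℕ) : MeasurePreserving (fun p : ℝ × (Fin n → ℝ) => (Fin.snoc p.2 p.1 : Fin (n+1) → ℝ))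
    (nu.prod (unif n)) (unif (n+1)) := by
  have := (measurePreserving_piFinSuccAbove (fun _ : Fin (n+1) => nu) (Fin.last n)).symm
  have e : (fun p : ℝ × (Fin n → ℝ) => (Fin.snoc p.2 p.1 : Fin (n+1) → ℝ))
      = (MeasurableEquiv.piFinSuccAbove (fun _ : Fin (n+1) => ℝ) (Fin.last n)).symm := by
    ext p i
    simp [MeasurableEquiv.piFinSuccAbove, Fin.insertNthEquiv, Fin.insertNth_last']
  rw [e]
  exact this

lemma me (n : ℕ) : MeasurableEmbedding (fun p : ℝ × (Fin n → ℝ) => (Fin.snoc p.2 p.1 : Fin (n+1) → ℝ)) := by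
  convert (MeasurableEquiv.piFinSuccAbove (fun _ : Fin (n+1) => ℝ) (Fin.last n)).symm.measurableEmbedding using 1
  ext p i
  simp [MeasurableEquiv.piFinSuccAbove, Fin.insertNthEquiv, Fin.insertNth_last']

lemma nd_int (α : ℝ) (hα : 0 < α) {m n : ℕ} {c : (Fin n → ℝ) → Fin (m+1) → ℝ} (hc : Measurable c)
    (h0 : ∀ u, c u 0 = 0) :
    Integrable (fun p : ℝ × (Fin n → ℝ) => (nd (c p.2) p.1)^α) (nu.prod (unif n)) := by
  refine Integrable.of_bound ((nd_meas hc).pow_const α).aestronglyMeasurable 1 ?_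
  have : ∀ᵐ p ∂(nu.prod (unif n)), p.1 ∈ Ioo (0:ℝ) 1 :=
    Measure.quasiMeasurePreserving_fst.ae (ae_restrict_mem measurableSet_Ioo)
  filter_upwards [this] with p hp
  rw [Real.norm_of_nonneg (Real.rpow_nonneg (nd_nonneg _ _) _)]
  refine Real.rpow_le_one (nd_nonneg _ _) ((nd_le _ _ 0).trans ?_) hα.le
  rw [h0, sub_zero, abs_of_pos hp.1]
  exact hp.2.le

lemma step {α : ℝ} (hα : 0 < α) {m n : ℕ} {c : (Fin n → ℝ) → Fin (m+1) → ℝ} (hc : Measurable c)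
    (h0 : ∀ u, c u 0 = 0) {c' : (Fin (n+1) → ℝ) → Fin (m+1+1) → ℝ}
    (hs : ∀ u a, c' (Fin.snoc u a : Fin (n+1) → ℝ) = Fin.snoc (c u) a)
    (hi : Integrable (fun u => ongWeight α (c u)) (unif n)) :
    Integrable (fun u => ongWeight α (c' u)) (unif (n+1)) ∧
    ∫ u, ongWeight α (c' u) ∂(unif (n+1)) = ∫ u, ongWeight α (c u) ∂(unif n)
      + ∫ p, (nd (c p.2) p.1)^α ∂(nu.prod (unif n)) := by
  have e : (fun u => ongWeight α (c' u)) ∘ (fun p : ℝ × (Fin n → ℝ) => (Fin.snoc p.2 p.1 : Fin (n+1) → ℝ))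
      = fun p => ongWeight α (c p.2) + (nd (c p.2) p.1)^α := by
    ext p
    simp only [Function.comp, hs, ong_snoc]
  have i1 : Integrable (fun p : ℝ × (Fin n → ℝ) => ongWeight α (c p.2)) (nu.prod (unif n)) :=
    hi.comp_snd nu
  have i2 := nd_int α hα hc h0
  constructor
  · rw [← (mp n).integrable_comp_emb (me n), e]
    exact i1.add i2
  · rw [← (mp n).integral_comp (me n)]
    have := congrArg (fun f => ∫ p, f p ∂(nu.prod (unif n))) e
    simp only [Function.comp] at this
    rw [this, integral_add i1 i2]
    congr 1
    have := integral_fun_snd (μ := nu) (ν := unif n) (fun u => ongWeight α (c u))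
    rw [this]; simp

lemma int0 {α : ℝ} (hα : 0 < α) (n : ℕ) : Integrable (fun u => ongWeight α (c0 u)) (unif n) := by
  induction n with
  | zero =>
    have : (fun u : Fin 0 → ℝ => ongWeight α (c0 u)) = fun _ => ongWeight α (c0 Fin.elim0) := by
      ext u; congr; exact Subsingleton.elim _ _
    rw [this]; exact integrable_const _
  | succ n ih => exact (step hα meas_c0 (fun _ => rfl) c0_snoc ih).1

lemma int1 {α : ℝ} (hα : 0 < α) (n : ℕ) : Integrable (fun u => ongWeight α (c1 u)) (unif n) := by
  induction n with
  | zero =>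
    have : (fun u : Fin 0 → ℝ => ongWeight α (c1 u)) = fun _ => ongWeight α (c1 Fin.elim0) := by
      ext u; congr; exact Subsingleton.elim _ _
    rw [this]; exact integrable_const _
  | succ n ih => exact (step hα meas_c1 (fun _ => rfl) c1_snoc ih).1

lemma val0 (α : ℝ) (u : Fin 0 → ℝ) : ongWeight α (c0 u) = 0 := by
  simp [ongWeight]

lemma val1 (α : ℝ) (u : Fin 0 → ℝ) : ongWeight α (c1 u) = 1 := by
  have h : {d : ℝ | ∃ j : Fin 2, (j : ℕ) < ((1 : Fin 2) : ℕ) ∧ d = |c1 u 1 - c1 u j|} = {1} := by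
    ext d
    simp [c1]
  unfold ongWeight
  simp only [Nat.reduceAdd] at *
  rw [Fin.sum_univ_two, h]
  simp

/-- rightmost point of `(0, u)` -/
noncomputable def M {n : ℕ} (u : Fin n → ℝ) : ℝ := ⨆ j, c0 u j

lemma meas_M {n : ℕ} : Measurable (M : (Fin n → ℝ) → ℝ) := by
  unfold M
  exact Measurable.iSup fun j => (measurable_pi_apply j).comp meas_c0

lemma le_M {n : ℕ} (u : Fin n → ℝ) (j) : c0 u j ≤ M u :=
  le_ciSup (Set.finite_range _).bddAbove j

lemma M_nonneg {n : ℕ} (u : Fin n → ℝ) : 0 ≤ M u := le_M u 0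

lemma M_lt {n : ℕ} (u : Fin n → ℝ) (hu : ∀ j, u j ∈ Ioo (0:ℝ) 1) : M u < 1 := by
  obtain ⟨j, hj⟩ := exists_eq_ciSup_of_finite (f := c0 u)
  unfold M
  rw [← hj]
  induction j using Fin.cases with
  | zero => simp [c0]
  | succ i => simpa [c0] using (hu i).2

lemma M_le_iff {n : ℕ} (u : Fin n → ℝ) {t : ℝ} (ht : 0 ≤ t) : M u ≤ t ↔ ∀ j, u j ≤ t := by
  unfold M
  rw [ciSup_le_iff (Set.finite_range _).bddAbove, Fin.forall_fin_succ]
  simp [c0, ht]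

lemma nd1_eq {n : ℕ} (u : Fin n → ℝ) {a : ℝ} (ha : a ≤ 1) :
    nd (c1 u) a = min (nd (c0 u) a) (1 - a) := by
  have h1 : |a - 1| = 1 - a := by rw [abs_sub_comm, abs_of_nonneg (by linarith)]
  apply le_antisymm
  · refine le_min (le_ciInf fun j => ?_) ?_
    · induction j using Fin.cases with
      | zero => exact nd_le (c1 u) a 0
      | succ i => exact nd_le (c1 u) a i.succ.succ
    · rw [← h1]
      exact nd_le (c1 u) a 1
  · refine le_ciInf fun j => ?_
    induction j using Fin.cases with
    | zero => exact (min_le_left _ _).trans (nd_le (c0 u) a 0)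
    | succ i =>
      induction i using Fin.cases with
      | zero => exact (min_le_right _ _).trans h1.ge
      | succ i => exact (min_le_left _ _).trans (nd_le (c0 u) a i.succ)

lemma D_eq (α : ℝ) {n : ℕ} (u : Fin n → ℝ) (hu : ∀ j, u j ∈ Ioo (0:ℝ) 1) {a : ℝ}
    (ha : a ∈ Ioo (0:ℝ) 1) :
    nd (c0 u) a ^ α - nd (c1 u) a ^ α
      = (Ioc ((1 + M u)/2) 1).indicator (fun a => (a - M u)^α - (1 - a)^α) a := by
  rw [nd1_eq u ha.2.le]
  obtain ⟨j, hj⟩ := exists_eq_ciSup_of_finite (f := c0 u)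
  change c0 u j = M u at hj
  have hM := M_lt u hu
  have hle := nd_le (c0 u) a j
  rw [hj] at hle
  by_cases h : (1 + M u)/2 < a
  · rw [indicator_of_mem (mem_Ioc.2 ⟨h, ha.2.le⟩)]
    have e : nd (c0 u) a = a - M u := by
      apply le_antisymm
      · rwa [abs_of_nonneg (by linarith)] at hle
      · refine le_ciInf fun i => ?_
        have := le_M u i
        exact le_trans (by linarith) (le_abs_self _)
    rw [e, min_eq_right (by linarith)]
  · rw [indicator_of_notMem (fun h' => h h'.1)]
    push Not at h
    rw [min_eq_left, sub_self]
    refine hle.trans (abs_le.2 ⟨?_, ?_⟩) <;> linarith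

lemma int_Ioo_indicator {f : ℝ → ℝ} {c : ℝ} (hc : 0 ≤ c) (hc1 : c ≤ 1) :
    ∫ a, (Ioc c 1).indicator f a ∂nu = ∫ a in c..1, f a := by
  rw [intervalIntegral.integral_of_le hc1, nu, ← integral_Ioc_eq_integral_Ioo,
    integral_indicator measurableSet_Ioc, Measure.restrict_restrict measurableSet_Ioc,
    inter_eq_left.2 (Ioc_subset_Ioc_left hc)]

lemma int_one_sub {α : ℝ} (hα : 0 < α) (c : ℝ) :
    ∫ t in c..1, (1 - t)^α = (1 - c)^(α+1)/(α+1) := by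
  rw [intervalIntegral.integral_comp_sub_left (fun x => x^α) 1, integral_rpow (Or.inl (by linarith))]
  rw [sub_self, Real.zero_rpow (by linarith), sub_zero]

lemma int_D {α : ℝ} (hα : 0 < α) {m : ℝ} (hm : 0 ≤ m) (hm1 : m < 1) :
    ∫ a, (Ioc ((1 + m)/2) 1).indicator (fun a => (a - m)^α - (1 - a)^α) a ∂nu
      = (1 - (2:ℝ)^(-α))/(α+1) * (1 - m)^(α+1) := by
  rw [int_Ioo_indicator (by linarith) (by linarith), intervalIntegral.integral_sub, int_one_sub hα,
    intervalIntegral.integral_comp_sub_right (fun x => x^α) m, integral_rpow (Or.inl (by linarith))]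
  · have e1 : 1 - (1+m)/2 = (1 - m) * 2⁻¹ := by ring
    have e2 : (1+m)/2 - m = (1 - m) * 2⁻¹ := by ring
    rw [e1, e2, Real.mul_rpow (by linarith) (by norm_num), Real.inv_rpow (by norm_num),
      Real.rpow_add (by norm_num : (0:ℝ) < 2), Real.rpow_one, Real.rpow_neg (by norm_num)]
    have : (2:ℝ)^α ≠ 0 := by positivity
    field_simp
    ring
  · apply Continuous.intervalIntegrable
    exact (continuous_id.sub continuous_const).rpow_const fun _ => Or.inr hα.le
  · apply Continuous.intervalIntegrable
    exact (continuous_const.sub continuous_id).rpow_const fun _ => Or.inr hα.le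

lemma unif_le (n : ℕ) {t : ℝ} (ht : t ∈ Ioo (0:ℝ) 1) :
    (unif n).real {u | M u ≤ t} = t^n := by
  have : {u : Fin n → ℝ | M u ≤ t} = univ.pi fun _ => Iic t := by
    ext u
    simp [M_le_iff u ht.1.le, Pi.le_def]
  rw [this, Measure.real, unif, Measure.pi_pi]
  have : (volume.restrict (Ioo (0:ℝ) 1)) (Iic t) = ENNReal.ofReal t := by
    rw [Measure.restrict_apply measurableSet_Iic]
    have : Iic t ∩ Ioo (0:ℝ) 1 = Ioc 0 t := by
      ext x
      simp only [mem_inter_iff, mem_Iic, mem_Ioo, mem_Ioc]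
      have := ht.2
      constructor
      · rintro ⟨h1, h2, h3⟩; exact ⟨h2, h1⟩
      · rintro ⟨h1, h2⟩; exact ⟨h2, h1, by linarith⟩
    rw [this]; simp
  simp [this, ht.1.le]

lemma beta_int {α : ℝ} (hα : 0 < α) (n : ℕ) :
    ∫ t, (1 - t)^α * t^n ∂nu
      = Real.Gamma (n+1) * Real.Gamma (α+1) / Real.Gamma (n+1+(α+1)) := by
  have h := ProbabilityTheory.beta_eq_betaIntegralReal (n+1) (α+1) (by positivity) (by positivity)
  rw [ProbabilityTheory.beta] at h
  rw [h, Complex.betaIntegral, nu, ← integral_Ioc_eq_integral_Ioo,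
    ← intervalIntegral.integral_of_le zero_le_one]
  have : ∫ t in (0:ℝ)..1, (t:ℂ) ^ (((n+1 : ℝ) : ℂ) - 1) * (1 - (t:ℂ)) ^ (((α+1 : ℝ):ℂ) - 1)
      = ∫ t in (0:ℝ)..1, (((1 - t)^α * t^n : ℝ) : ℂ) := by
    refine intervalIntegral.integral_congr fun t ht => ?_
    rw [uIcc_of_le zero_le_one] at ht
    push_cast
    rw [add_sub_cancel_right, add_sub_cancel_right, Complex.ofReal_cpow (by linarith [ht.2]),
      Complex.cpow_natCast, mul_comm]
    push_cast
    rfl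
  rw [this, intervalIntegral.integral_ofReal, Complex.ofReal_re]

lemma int_M {α : ℝ} (hα : 0 < α) (n : ℕ) :
    ∫ u, (1 - M u)^(α+1) ∂(unif n)
      = (α + 1) * (Real.Gamma (n+1) * Real.Gamma (α+1) / Real.Gamma (n+1+(α+1))) := by
  have e : ∀ᵐ u ∂(unif n), (1 - M u)^(α+1)
      = ∫ t, (if M u ≤ t then (α+1) * (1 - t)^α else 0) ∂nu := by
    filter_upwards [ae_unif n] with u hu
    have h := int_one_sub hα (M u)
    have h2 : ∫ t, (if M u ≤ t then (α+1) * (1 - t)^α else 0) ∂nu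
        = ∫ t, (Ioc (M u) 1).indicator (fun t => (α+1) * (1 - t)^α) t ∂nu := by
      refine integral_congr_ae ?_
      have hne : ∀ᵐ t ∂nu, t ≠ M u := ae_restrict_of_ae (by simp [ae_iff])
      filter_upwards [ae_restrict_mem measurableSet_Ioo, hne] with t ht hn
      by_cases hh : M u ≤ t
      · rw [if_pos hh, indicator_of_mem (mem_Ioc.2 ⟨lt_of_le_of_ne hh hn.symm, ht.2.le⟩)]
      · rw [if_neg hh, indicator_of_notMem (fun h' => hh h'.1.le)]
    rw [h2, int_Ioo_indicator (M_nonneg u) (M_lt u hu).le, intervalIntegral.integral_const_mul, h]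
    field_simp
  rw [integral_congr_ae e, integral_integral_swap]
  · rw [← beta_int hα, ← integral_const_mul]
    refine integral_congr_ae ?_
    filter_upwards [ae_restrict_mem measurableSet_Ioo] with t ht
    have : (fun u : Fin n → ℝ => if M u ≤ t then (α+1) * (1 - t)^α else 0)
        = {u : Fin n → ℝ | M u ≤ t}.indicator fun _ => (α+1) * (1 - t)^α := by
      ext u
      simp [indicator]
    rw [this, integral_indicator_const _ (measurableSet_le meas_M measurable_const), unif_le n ht]
    simp only [smul_eq_mul]
    ring
  · refine Integrable.of_bound (C := α + 1) ?_ ?_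
    · refine Measurable.aestronglyMeasurable ?_
      refine Measurable.ite (measurableSet_le (meas_M.comp measurable_fst) measurable_snd) ?_ measurable_const
      exact measurable_const.mul ((measurable_const.sub measurable_snd).pow_const α)
    · have : ∀ᵐ p ∂((unif n).prod nu), p.2 ∈ Ioo (0:ℝ) 1 :=
        Measure.quasiMeasurePreserving_snd.ae (ae_restrict_mem measurableSet_Ioo)
      filter_upwards [this] with p hp
      simp only [Function.uncurry]
      have h1 : 0 ≤ (1 - p.2)^α := Real.rpow_nonneg (by linarith [hp.2]) _
      have h2 : (1 - p.2)^α ≤ 1 := Real.rpow_le_one (by linarith [hp.2]) (by linarith [hp.1]) hα.le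
      split_ifs
      · rw [Real.norm_of_nonneg (by positivity)]
        nlinarith
      · rw [norm_zero]; positivity

lemma F_step {α : ℝ} (hα : 0 < α) (n : ℕ) :
    ∫ p, (nd (c0 p.2) p.1)^α ∂(nu.prod (unif n)) - ∫ p, (nd (c1 p.2) p.1)^α ∂(nu.prod (unif n))
     = (1 - (2:ℝ)^(-α)) * (Real.Gamma (n+1) * Real.Gamma (α+1) / Real.Gamma (n+1+(α+1))) := by
  have i0 := nd_int α hα (n := n) meas_c0 (fun _ => rfl)
  have i1 := nd_int α hα (n := n) meas_c1 (fun _ => rfl)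
  have i2 : Integrable (fun p : ℝ × (Fin n → ℝ) => nd (c0 p.2) p.1 ^ α - nd (c1 p.2) p.1 ^ α)
      (nu.prod (unif n)) := i0.sub i1
  rw [← integral_sub i0 i1, integral_prod_symm _ i2]
  have : ∀ᵐ u ∂(unif n), ∫ a, (nd (c0 u) a ^ α - nd (c1 u) a ^ α) ∂nu
      = (1 - (2:ℝ)^(-α))/(α+1) * (1 - M u)^(α+1) := by
    filter_upwards [ae_unif n] with u hu
    rw [← int_D hα (M_nonneg u) (M_lt u hu)]
    refine integral_congr_ae ?_
    filter_upwards [ae_restrict_mem measurableSet_Ioo] with a ha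
    exact D_eq α u hu ha
  rw [integral_congr_ae this, integral_const_mul, int_M hα]
  field_simp

lemma main_eq {α : ℝ} (hα : 0 < α) (n : ℕ) :
    (∫ u, ongWeight α (c0 u) ∂(unif n)) - (∫ u, ongWeight α (c1 u) ∂(unif n))
      = (1 - (2:ℝ)^(-α) - α)/α
        + ((2:ℝ)^(-α) - 1) * Real.Gamma α * Real.Gamma ((n:ℝ)+1)
            / Real.Gamma ((n:ℝ)+1+α) := by
  induction n with
  | zero =>
    have hg := (Real.Gamma_pos_of_pos hα).ne'
    simp only [val0, val1]
    simp only [integral_const, CharP.cast_eq_zero, zero_add, Real.Gamma_one, add_comm 1 α,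
      Real.Gamma_add_one hα.ne', probReal_univ, smul_eq_mul]
    field_simp
    ring
  | succ n ih =>
    rw [(step hα meas_c0 (fun _ => rfl) c0_snoc (int0 hα n)).2,
      (step hα meas_c1 (fun _ => rfl) c1_snoc (int1 hα n)).2, add_sub_add_comm, ih, F_step hα]
    have hg := (Real.Gamma_pos_of_pos (show (0:ℝ) < n + 1 + α by positivity)).ne'
    push_cast
    rw [show (n:ℝ) + 1 + 1 + α = n + 1 + α + 1 by ring, show (n:ℝ) + 1 + (α + 1) = n + 1 + α + 1 by ring,
      Real.Gamma_add_one hα.ne', Real.Gamma_add_one (show (n:ℝ) + 1 + α ≠ 0 by positivity),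
      Real.Gamma_add_one (show (n:ℝ) + 1 ≠ 0 by positivity)]
    have : (n:ℝ) + 1 + α ≠ 0 := by positivity
    field_simp
    ring

lemma prod_eq {α : ℝ} (hα : 0 < α) (n : ℕ) :
    Real.Gamma (n + α) = Real.Gamma α * ∏ j ∈ Finset.range n, (α + j) := by
  induction n with
  | zero => simp
  | succ n ih =>
    rw [Finset.prod_range_succ, ← mul_assoc, ← ih]
    push_cast
    rw [show (n:ℝ) + 1 + α = n + α + 1 by ring, Real.Gamma_add_one (by positivity)]
    ring

lemma main_O {α : ℝ} (hα : 0 < α) :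
    (fun n : ℕ => ((2:ℝ)^(-α) - 1) * Real.Gamma α * Real.Gamma ((n:ℝ)+1)
            / Real.Gamma ((n:ℝ)+1+α)) =O[atTop] fun n : ℕ => (n:ℝ)^(-α) := by
  have h : (fun n : ℕ => ((2:ℝ)^(-α) - 1) * Real.Gamma α * Real.Gamma ((n:ℝ)+1)
            / Real.Gamma ((n:ℝ)+1+α)) =ᶠ[atTop]
      fun n : ℕ => (((2:ℝ)^(-α) - 1) * Real.GammaSeq α n) * (n:ℝ)^(-α) := by
    filter_upwards [eventually_gt_atTop 0] with n hn
    have hn' : (0:ℝ) < n := by exact_mod_cast hn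
    have hp := prod_eq hα (n+1)
    have hg := (Real.Gamma_pos_of_pos hα).ne'
    have hx : (n:ℝ)^α ≠ 0 := by positivity
    have hq : ∏ j ∈ Finset.range (n+1), (α + (j:ℝ)) ≠ 0 :=
      Finset.prod_ne_zero_iff.2 fun j _ => by positivity
    push_cast at hp
    rw [hp, Real.Gamma_nat_eq_factorial, Real.GammaSeq, Real.rpow_neg hn'.le (y := α)]
    field_simp
  refine h.trans_isBigO ?_
  have := ((Real.GammaSeq_tendsto_Gamma α).const_mul ((2:ℝ)^(-α) - 1)).isBigO_one ℝ
  simpa using this.mul (Asymptotics.isBigO_refl (fun n : ℕ => (n:ℝ)^(-α)) atTop)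

end OngAux

/-- For `α > 0` and `n ≥ 2`, the difference between the expected ONG weights on
`(0, U₁, …, U_n)` and on `(0, 1, U₁, …, U_n)` equals
`(1-2^(-α)-α)/α + (2^(-α)-1)Γ(α)Γ(n+1)/Γ(n+1+α)`, which is
`(1-2^(-α)-α)/α + O(n^(-α))`. -/
theorem ong_zero_vs_zero_one_difference (α : ℝ) (hα : 0 < α) :
    (∀ n : ℕ, 2 ≤ n →
      (∫ u, ongWeight α (Fin.cons 0 u) ∂(unif n))
        - (∫ u, ongWeight α (Fin.cons 0 (Fin.cons 1 u)) ∂(unif n))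
      = (1 - (2:ℝ)^(-α) - α)/α
        + ((2:ℝ)^(-α) - 1) * Real.Gamma α * Real.Gamma ((n:ℝ)+1)
            / Real.Gamma ((n:ℝ)+1+α))
    ∧ (fun n : ℕ =>
        (∫ u, ongWeight α (Fin.cons 0 u) ∂(unif n))
          - (∫ u, ongWeight α (Fin.cons 0 (Fin.cons 1 u)) ∂(unif n))
          - (1 - (2:ℝ)^(-α) - α)/α)
        =O[Filter.atTop] fun n : ℕ => (n:ℝ)^(-α) := by
  have key := fun n => OngAux.main_eq hα n
  constructor
  · intro n _
    exact key n
  · refine (OngAux.main_O hα).congr_left fun n => ?_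
    have := key n
    unfold OngAux.c0 OngAux.c1 at this
    rw [this]
    ring
end

section
/- For n ≥ 3, E[(min{S_1^n, S_2^n})^α (min{S_2^n, S_3^n})^α] = 3^{-1-2α}Γ(1+2α)Γ(n+1)/Γ(n+1+2α) + 4·E[(S_1^n)^α(S_2^n)^α 1{S_1^n < S_2^n < S_3^n}], and E[(S_2^n)^{2α} 1{S_2^n < S_1^n, S_2^n < S_3^n}] = (1/3)E[(min{S_1^n,S_2^n,S_3^n})^{2α}] = 3^{-1-2α}Γ(1+2α)Γ(n+1)/Γ(n+1+2α). -/
open MeasureTheory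

def chamber {n : ℕ} (σ : Equiv.Perm (Fin n)) : Set (Fin n → ℝ) := {u | StrictMono (u ∘ σ)}

lemma sort_eq_of_chamber {n : ℕ} {σ : Equiv.Perm (Fin n)} {u : Fin n → ℝ} (h : u ∈ chamber σ) :
    Tuple.sort u = σ := by
  symm
  rw [Tuple.eq_sort_iff]
  refine ⟨StrictMono.monotone h, fun i j hij he => ?_⟩
  exact absurd he (ne_of_lt (h hij))

lemma measurableSet_chamber {n : ℕ} (σ : Equiv.Perm (Fin n)) : MeasurableSet (chamber σ) := by
  have : chamber σ = ⋂ i, ⋂ j, ⋂ (_ : i < j), {u : Fin n → ℝ | u (σ i) < u (σ j)} := by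
    ext u
    simp only [chamber, Set.mem_ofPred_eq, Set.mem_iInter, StrictMono, Function.comp]
  rw [this]
  refine MeasurableSet.iInter fun i => MeasurableSet.iInter fun j => MeasurableSet.iInter fun _ => ?_
  exact measurableSet_lt (measurable_pi_apply _) (measurable_pi_apply _)

lemma measurable_ostat {n : ℕ} (k : Fin n) : Measurable fun u : Fin n → ℝ => ostat u k := by
  let _ : MeasurableSpace (Equiv.Perm (Fin n)) := ⊤
  have h1 : Measurable (fun u : Fin n → ℝ => Tuple.sort u) := by
    refine measurable_to_countable' fun σ => ?_
    have : (fun u : Fin n → ℝ => Tuple.sort u) ⁻¹' {σ} =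
        (⋂ i, ⋂ j, ⋂ (_ : i ≤ j), {u : Fin n → ℝ | u (σ i) ≤ u (σ j)}) ∩
        (⋂ i, ⋂ j, ⋂ (_ : i < j), ({u : Fin n → ℝ | u (σ i) = u (σ j)}ᶜ ∪ {_u | σ i < σ j})) := by
      ext u
      simp only [Set.mem_preimage, Set.mem_singleton_iff, eq_comm (b := σ), Tuple.eq_sort_iff,
        Monotone, Set.mem_inter_iff, Set.mem_iInter, Set.mem_ofPred_eq, Function.comp,
        Set.mem_union, Set.mem_compl_iff, imp_iff_not_or]
    rw [this]
    refine MeasurableSet.inter ?_ ?_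
    · refine MeasurableSet.iInter fun i => MeasurableSet.iInter fun j =>
        MeasurableSet.iInter fun _ => ?_
      exact measurableSet_le (measurable_pi_apply _) (measurable_pi_apply _)
    · refine MeasurableSet.iInter fun i => MeasurableSet.iInter fun j =>
        MeasurableSet.iInter fun _ => ?_
      refine MeasurableSet.union (MeasurableSet.compl ?_) (MeasurableSet.const _)
      exact measurableSet_eq_fun (measurable_pi_apply _) (measurable_pi_apply _)
  have h2 : Measurable (fun p : Equiv.Perm (Fin n) × (Fin n → ℝ) => p.2 (p.1 k)) :=
    measurable_from_prod_countable_right fun σ => measurable_pi_apply (σ k)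
  exact h2.comp (h1.prodMk measurable_id)

lemma measurable_spacing {n : ℕ} (j : Fin (n+1)) :
    Measurable fun u : Fin n → ℝ => spacing u j := by
  unfold spacing
  refine Measurable.sub ?_ ?_
  · split_ifs
    · exact measurable_ostat _
    · exact measurable_const
  · split_ifs
    · exact measurable_ostat _
    · exact measurable_const

lemma unif_eq (n : ℕ) : unif n =
    volume.restrict (Set.univ.pi fun _ : Fin n => Set.Ioo (0:ℝ) 1) := by
  rw [volume_pi, Measure.restrict_pi_pi]; rfl

instance inst_s16 (n : ℕ) : IsProbabilityMeasure (unif n) := by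
  have : IsProbabilityMeasure (volume.restrict (Set.Ioo (0:ℝ) 1)) := ⟨by simp⟩
  unfold unif; infer_instance

lemma null_lin {n : ℕ} (i j : Fin n) (hij : i ≠ j) (c : ℝ) :
    volume {u : Fin n → ℝ | c * u i = u j} = 0 := by
  let L : (Fin n → ℝ) →ₗ[ℝ] ℝ := c • LinearMap.proj i - LinearMap.proj j
  have h : {u : Fin n → ℝ | c * u i = u j} = (LinearMap.ker L : Set (Fin n → ℝ)) := by
    ext u
    simp [L, sub_eq_zero]
  rw [h]
  refine Measure.addHaar_submodule _ _ ?_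
  intro htop
  have : (Pi.single j 1 : Fin n → ℝ) ∈ LinearMap.ker L := by rw [htop]; trivial
  simp [L, hij] at this

lemma ae_chamber (n : ℕ) : ∀ᵐ u : Fin n → ℝ, u ∈ chamber (Tuple.sort u) := by
  have h : ∀ᵐ u : Fin n → ℝ, ∀ i j, i ≠ j → u i ≠ u j := by
    rw [ae_all_iff]; intro i
    rw [ae_all_iff]; intro j
    by_cases hij : i = j
    · simp [hij]
    · have := null_lin i j hij 1
      simp only [one_mul] at this
      rw [ae_iff]
      simpa [hij] using this
  filter_upwards [h] with u hu
  refine (Tuple.monotone_sort u).strictMono_of_injective ?_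
  refine Function.Injective.comp ?_ (Equiv.injective _)
  intro i j he
  by_contra hne
  exact hu i j hne he

lemma measure_chambers {n : ℕ} (s : Set (Fin n → ℝ)) (hs : MeasurableSet s) :
    volume s = ∑ σ : Equiv.Perm (Fin n), volume (s ∩ chamber σ) := by
  rw [← tsum_fintype (L := .unconditional _), ← measure_iUnion]
  · apply measure_congr
    filter_upwards [ae_chamber n] with u hu
    apply propext
    constructor
    · intro h
      exact Set.mem_iUnion.2 ⟨_, h, hu⟩
    · intro h
      obtain ⟨_, h, _⟩ := Set.mem_iUnion.1 h
      exact h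
  · intro σ τ hne
    rw [Function.onFun, Set.disjoint_left]
    rintro u ⟨_, h1⟩ ⟨_, h2⟩
    exact hne ((sort_eq_of_chamber h1).symm.trans (sort_eq_of_chamber h2))
  · exact fun σ => hs.inter (measurableSet_chamber σ)

lemma spacing0 {m : ℕ} (u : Fin (m+3) → ℝ) : spacing u 0 = ostat u 0 := by
  simp [spacing]
lemma spacing1 {m : ℕ} (u : Fin (m+3) → ℝ) : spacing u 1 = ostat u 1 - ostat u 0 := by
  unfold spacing
  have h1 : ((1 : Fin (m+3+1)) : ℕ) = 1 := by simp
  rw [dif_pos (by rw [h1]; omega), dif_pos (by rw [h1]; omega)]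
  rfl
lemma spacing2 {m : ℕ} (u : Fin (m+3) → ℝ) : spacing u 2 = ostat u 2 - ostat u 1 := by
  unfold spacing
  have h1 : ((2 : Fin (m+3+1)) : ℕ) = 2 := by
    rw [Fin.val_two]
  rw [dif_pos (by rw [h1]; omega), dif_pos (by rw [h1]; omega)]
  rfl

lemma key_set {m : ℕ} (σ : Equiv.Perm (Fin (m+3))) (a b c : ℝ) (ha : 0 ≤ a) (hb : 0 ≤ b)
    (hc : 0 ≤ c) (d : Fin (m+3) → ℝ)
    (hd : d = fun k : Fin (m+3) => if (k:ℕ) = 0 then a else if (k:ℕ) = 1 then a + b else a + b + c) :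
    ({u | a < spacing u 0 ∧ b < spacing u 1 ∧ c < spacing u 2} ∩
      (Set.univ.pi fun _ : Fin (m+3) => Set.Ioo (0:ℝ) 1)) ∩ chamber σ =
    (fun u => u + (-(d ∘ σ.symm))) ⁻¹'
      ((Set.univ.pi fun _ : Fin (m+3) => Set.Ioo (0:ℝ) (1 - a - b - c)) ∩ chamber σ) := by
  have hd0 : d 0 = a := by simp [hd]
  have hd1 : d 1 = a + b := by simp [hd]
  have hd2 : d 2 = a + b + c := by
    have h1 : ((2 : Fin (m+3)) : ℕ) = 2 := by rw [Fin.val_two]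
    rw [hd]; dsimp only; rw [h1]; simp
  have hdl : d (Fin.last _) = a + b + c := by simp [hd]
  have hle : ∀ k, 0 ≤ d k ∧ d k ≤ a + b + c := by
    intro k; rw [hd]; dsimp only; split_ifs <;> constructor <;> linarith
  have hstep : ∀ i : Fin (m+2), d i.castSucc ≤ d i.succ := by
    intro i; rw [hd]; simp only [Fin.val_castSucc, Fin.val_succ]
    split_ifs <;> first | contradiction | linarith | omega
  have hstep2 : ∀ i : Fin (m+2), i ≠ 0 → i ≠ 1 → d i.succ = d i.castSucc := by
    intro i h0 h1
    have h0' : (i:ℕ) ≠ 0 := fun h => h0 (Fin.ext (by rw [h]; rfl))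
    have h1' : (i:ℕ) ≠ 1 := fun h => h1 (Fin.ext (by rw [h]; rfl))
    rw [hd]; simp only [Fin.val_castSucc, Fin.val_succ]
    split_ifs <;> first | contradiction | rfl | omega
  have c0 : (0 : Fin (m+2)).castSucc = 0 := rfl
  have c1 : (1 : Fin (m+2)).castSucc = 1 := rfl
  have s0 : (0 : Fin (m+2)).succ = 1 := rfl
  have s1 : (1 : Fin (m+2)).succ = 2 := rfl
  ext u
  simp only [Set.mem_inter_iff, Set.mem_preimage, Set.mem_ofPred_eq]
  set w : Fin (m+3) → ℝ := u ∘ σ with hw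
  have e1 : (u ∈ Set.univ.pi fun _ : Fin (m+3) => Set.Ioo (0:ℝ) 1) ↔ ∀ k, 0 < w k ∧ w k < 1 := by
    simp only [Set.mem_pi, Set.mem_univ, true_imp_iff, Set.mem_Ioo, hw, Function.comp]
    exact ⟨fun h k => h _, fun h k => by simpa using h (σ.symm k)⟩
  have e2 : (u + -(d ∘ σ.symm) ∈ Set.univ.pi fun _ : Fin (m+3) => Set.Ioo (0:ℝ) (1-a-b-c)) ↔
      ∀ k, 0 < w k - d k ∧ w k - d k < 1 - a - b - c := by
    simp only [Set.mem_pi, Set.mem_univ, true_imp_iff, Set.mem_Ioo, hw, Function.comp,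
      Pi.add_apply, Pi.neg_apply, ← sub_eq_add_neg]
    exact ⟨fun h k => by simpa using h (σ k), fun h k => by simpa using h (σ.symm k)⟩
  have e3 : u + -(d ∘ σ.symm) ∈ chamber σ ↔ StrictMono (fun k => w k - d k) := by
    have : (u + -(d ∘ σ.symm)) ∘ σ = fun k => w k - d k := by
      ext k; simp [hw, sub_eq_add_neg]
    simp only [chamber, Set.mem_ofPred_eq, this]
  rw [e1, e2, e3]
  constructor
  · rintro ⟨⟨⟨h0, h1, h2⟩, hb1⟩, hch⟩
    have hos : ostat u = w := by rw [ostat, sort_eq_of_chamber hch]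
    rw [spacing0, hos] at h0
    rw [spacing1, hos] at h1
    rw [spacing2, hos] at h2
    have hw' : StrictMono w := hch
    have hsm : StrictMono (fun k => w k - d k) := by
      rw [Fin.strictMono_iff_lt_succ]
      intro i
      by_cases i0 : i = 0
      · subst i0; rw [c0, s0, hd0, hd1]; linarith
      by_cases i1 : i = 1
      · subst i1; rw [c1, s1, hd1, hd2]; linarith
      rw [hstep2 i i0 i1]
      have := hw' (Fin.castSucc_lt_succ (i := i))
      linarith
    refine ⟨fun k => ⟨?_, ?_⟩, hsm⟩
    · have := hsm.monotone (Fin.zero_le k)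
      simp only [hd0] at this
      linarith
    · have := hsm.monotone (Fin.le_last k)
      simp only [hdl] at this
      have := (hb1 (Fin.last _)).2
      linarith
  · rintro ⟨hb1, hsm⟩
    have hw' : StrictMono w := by
      rw [Fin.strictMono_iff_lt_succ]
      intro i
      have := hsm (Fin.castSucc_lt_succ (i := i))
      have := hstep i
      simp only at *
      linarith
    have hch : u ∈ chamber σ := hw'
    have hos : ostat u = w := by rw [ostat, sort_eq_of_chamber hch]
    rw [spacing0, spacing1, spacing2, hos]
    have h0 := (hb1 0).1
    have h1 := hsm (Fin.castSucc_lt_succ (i := (0 : Fin (m+2))))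
    have h2 := hsm (Fin.castSucc_lt_succ (i := (1 : Fin (m+2))))
    simp only [c0, c1, s0, s1, hd0, hd1, hd2] at h0 h1 h2
    refine ⟨⟨⟨by linarith, by linarith, by linarith⟩, fun k => ?_⟩, hch⟩
    have := hle k
    have := hb1 k
    constructor <;> linarith

lemma surv {m : ℕ} (a b c : ℝ) (ha : 0 ≤ a) (hb : 0 ≤ b) (hc : 0 ≤ c) :
    unif (m+3) {u | a < spacing u 0 ∧ b < spacing u 1 ∧ c < spacing u 2} =
      ENNReal.ofReal (1 - a - b - c) ^ (m+3) := by
  have hm : MeasurableSet {u : Fin (m+3) → ℝ | a < spacing u 0 ∧ b < spacing u 1 ∧ c < spacing u 2} :=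
    (measurableSet_lt measurable_const (measurable_spacing 0)).inter
      ((measurableSet_lt measurable_const (measurable_spacing 1)).inter
      (measurableSet_lt measurable_const (measurable_spacing 2)))
  have hbox : ∀ s : ℝ, MeasurableSet (Set.univ.pi fun _ : Fin (m+3) => Set.Ioo (0:ℝ) s) :=
    fun s => MeasurableSet.univ_pi fun _ => measurableSet_Ioo
  rw [unif_eq, Measure.restrict_apply hm, measure_chambers _ (hm.inter (hbox 1))]
  simp_rw [key_set _ a b c ha hb hc _ rfl, measure_preimage_add_right]
  rw [← measure_chambers _ (hbox _), Real.volume_pi_Ioo]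
  simp

noncomputable def v3 {m : ℕ} (u : Fin (m+3) → ℝ) : Fin 3 → ℝ :=
  ![spacing u 0, spacing u 1, spacing u 2]

lemma measurable_v3 {m : ℕ} : Measurable (v3 : (Fin (m+3) → ℝ) → Fin 3 → ℝ) := by
  rw [measurable_pi_iff]
  intro i
  fin_cases i
  · exact measurable_spacing 0
  · exact measurable_spacing 1
  · exact measurable_spacing 2

noncomputable def law (m : ℕ) : Measure (Fin 3 → ℝ) := (unif (m+3)).map v3

instance (m : ℕ) : IsProbabilityMeasure (law m) :=
  Measure.isProbabilityMeasure_map measurable_v3.aemeasurable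

lemma law_box {m : ℕ} (t : Fin 3 → ℝ) (ht : ∀ i, 0 ≤ t i) :
    law m (Set.univ.pi fun i => Set.Ioi (t i)) = ENNReal.ofReal (1 - ∑ i, t i) ^ (m+3) := by
  rw [law, Measure.map_apply measurable_v3 (MeasurableSet.univ_pi fun _ => measurableSet_Ioi)]
  have := surv (m := m) (t 0) (t 1) (t 2) (ht 0) (ht 1) (ht 2)
  rw [Fin.sum_univ_three, show 1 - (t 0 + t 1 + t 2) = 1 - t 0 - t 1 - t 2 by ring, ← this]
  congr 1
  ext u
  simp [v3, Fin.forall_fin_succ]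

lemma law_pos (m : ℕ) : ∀ᵐ x ∂(law m), ∀ i, 0 < x i := by
  have h := law_box (m := m) (fun _ => 0) (fun _ => le_rfl)
  have hm : MeasurableSet (Set.univ.pi fun _ : Fin 3 => Set.Ioi (0:ℝ)) :=
    MeasurableSet.univ_pi fun _ => measurableSet_Ioi
  simp only [Finset.sum_const_zero, sub_zero, ENNReal.ofReal_one, one_pow] at h
  have h2 := (prob_compl_eq_zero_iff hm).2 h
  rw [ae_iff]
  convert h2 using 2
  ext x
  simp

lemma law_box' {m : ℕ} (t : Fin 3 → ℝ) :
    law m (Set.univ.pi fun i => Set.Ioi (t i)) =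
      ENNReal.ofReal (1 - ∑ i, max (t i) 0) ^ (m+3) := by
  rw [← law_box _ (fun i => le_max_right _ _)]
  apply measure_congr
  filter_upwards [law_pos m] with x hx
  apply propext
  change x ∈ (Set.univ.pi fun i => Set.Ioi (t i)) ↔ x ∈ (Set.univ.pi fun i => Set.Ioi (max (t i) 0))
  simp only [Set.mem_pi, Set.mem_univ, true_imp_iff, Set.mem_Ioi, max_lt_iff]
  exact ⟨fun h i => ⟨h i, hx i⟩, fun h i => (h i).1⟩

lemma measurable_perm (τ : Equiv.Perm (Fin 3)) : Measurable (fun x : Fin 3 → ℝ => x ∘ τ) :=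
  measurable_pi_iff.2 fun i => measurable_pi_apply (τ i)

lemma law_perm (m : ℕ) (τ : Equiv.Perm (Fin 3)) : (law m).map (fun x => x ∘ τ) = law m := by
  have : IsProbabilityMeasure ((law m).map (fun x => x ∘ τ)) :=
    Measure.isProbabilityMeasure_map (measurable_perm τ).aemeasurable
  refine ext_of_generate_finite
    (Set.univ.pi '' Set.univ.pi fun _ : Fin 3 => Set.range (Set.Ioi : ℝ → Set ℝ)) ?_
    (IsPiSystem.pi fun _ => isPiSystem_Ioi) ?_ (by simp)
  · refine (generateFrom_eq_pi (fun _ => ?_) (fun _ => ?_)).symm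
    · rw [BorelSpace.measurable_eq (α := ℝ), borel_eq_generateFrom_Ioi]
    · refine ⟨fun k : ℕ => Set.Ioi (-(k:ℝ)), fun k => ⟨_, rfl⟩, ?_⟩
      ext x
      simp only [Set.mem_iUnion, Set.mem_Ioi, Set.mem_univ, iff_true]
      obtain ⟨k, hk⟩ := exists_nat_gt (-x)
      exact ⟨k, by linarith⟩
  · rintro _ ⟨s, hs, rfl⟩
    have hs' : ∀ i, ∃ t, Set.Ioi t = s i := fun i => hs i (Set.mem_univ i)
    choose t ht using hs'
    obtain rfl : (fun i => Set.Ioi (t i)) = s := funext ht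
    rw [Measure.map_apply (measurable_perm τ) (MeasurableSet.univ_pi fun _ => measurableSet_Ioi)]
    have : (fun x : Fin 3 → ℝ => x ∘ τ) ⁻¹' (Set.univ.pi fun i => Set.Ioi (t i)) =
        Set.univ.pi fun i => Set.Ioi ((t ∘ τ.symm) i) := by
      ext x
      simp only [Set.mem_preimage, Set.mem_pi, Set.mem_univ, true_imp_iff, Set.mem_Ioi,
        Function.comp]
      exact ⟨fun h k => by simpa using h (τ.symm k), fun h k => by simpa using h (τ k)⟩
    rw [this, law_box', law_box']
    congr 3
    exact Equiv.sum_comp τ.symm (fun i => max (t i) 0)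

lemma law_ae_perm {m : ℕ} (τ : Equiv.Perm (Fin 3)) {p : (Fin 3 → ℝ) → Prop}
    (h : ∀ᵐ x ∂(law m), p x) : ∀ᵐ x ∂(law m), p (x ∘ τ) := by
  rw [← law_perm m τ] at h
  exact ae_of_ae_map (measurable_perm τ).aemeasurable h

lemma law_int_perm {m : ℕ} (τ : Equiv.Perm (Fin 3)) {F : (Fin 3 → ℝ) → ℝ} (hF : Measurable F) :
    ∫ x, F (x ∘ τ) ∂(law m) = ∫ x, F x ∂(law m) := by
  conv_rhs => rw [← law_perm m τ]
  rw [integral_map (measurable_perm τ).aemeasurable hF.aestronglyMeasurable]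

lemma unif_ac (n : ℕ) : unif n ≪ volume := by
  rw [unif_eq]; exact Measure.restrict_le_self.absolutelyContinuous

lemma law_ties0 (m : ℕ) : ∀ᵐ x ∂(law m), x 0 ≠ x 1 := by
  have hms : MeasurableSet {x : Fin 3 → ℝ | x 0 ≠ x 1} :=
    (measurableSet_eq_fun (measurable_pi_apply (0 : Fin 3)) (measurable_pi_apply 1)).compl
  rw [law, ae_map_iff measurable_v3.aemeasurable hms]
  apply (unif_ac _).ae_le
  have h : ∀ᵐ u : Fin (m+3) → ℝ, ∀ i j, i ≠ j → 2 * u i ≠ u j := by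
    rw [ae_all_iff]; intro i
    rw [ae_all_iff]; intro j
    by_cases hij : i = j
    · simp [hij]
    · have := null_lin i j hij 2
      rw [ae_iff]
      simpa [hij] using this
  filter_upwards [h] with u hu
  simp only [v3, Matrix.cons_val_zero, Matrix.cons_val_one]
  rw [spacing0, spacing1]
  intro he
  refine hu (Tuple.sort u 0) (Tuple.sort u 1) ?_ ?_
  · intro h; have := (Tuple.sort u).injective h
    simp at this
  · simp only [ostat, Function.comp] at he
    linarith

lemma law_ties (m : ℕ) : ∀ᵐ x ∂(law m), ∀ i j, i ≠ j → x i ≠ x j := by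
  rw [ae_all_iff]; intro i
  rw [ae_all_iff]; intro j
  by_cases hij : i = j
  · simp [hij]
  have key : ∀ i j : Fin 3, i ≠ j → ∃ τ : Equiv.Perm (Fin 3), τ 0 = i ∧ τ 1 = j := by decide
  obtain ⟨τ, h0, h1⟩ := key i j hij
  filter_upwards [law_ae_perm τ (law_ties0 m)] with x hx _
  simpa [h0, h1] using hx

lemma law_lt_one (m : ℕ) : ∀ᵐ x ∂(law m), ∀ i, x i < 1 := by
  have h0 : ∀ᵐ x ∂(law m), x 0 < 1 := by
    have hms : MeasurableSet {x : Fin 3 → ℝ | x 0 < 1} :=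
      measurableSet_lt (measurable_pi_apply _) measurable_const
    rw [law, ae_map_iff measurable_v3.aemeasurable hms, unif_eq]
    filter_upwards [ae_restrict_mem (MeasurableSet.univ_pi fun _ => measurableSet_Ioo)] with u hu
    simp only [v3, Matrix.cons_val_zero]
    rw [spacing0]
    exact (hu _ (Set.mem_univ _)).2
  rw [ae_all_iff]; intro i
  filter_upwards [law_ae_perm (Equiv.swap 0 i) h0] with x hx
  simpa using hx

lemma int_bdd {m : ℕ} {F : (Fin 3 → ℝ) → ℝ} (hF : Measurable F)
    (hb : ∀ x : Fin 3 → ℝ, (∀ i, 0 < x i) → (∀ i, x i < 1) → |F x| ≤ 1) :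
    Integrable F (law m) := by
  refine Integrable.of_bound hF.aestronglyMeasurable 1 ?_
  filter_upwards [law_pos m, law_lt_one m] with x h0 h1
  exact hb x h0 h1

noncomputable def FF (p : ℝ) (x : Fin 3 → ℝ) : ℝ := if x 1 < x 0 ∧ x 1 < x 2 then x 1 ^ p else 0
noncomputable def GG (α : ℝ) (x : Fin 3 → ℝ) : ℝ :=
  if x 0 < x 1 ∧ x 1 < x 2 then x 0 ^ α * x 1 ^ α else 0

lemma measurable_FF (p : ℝ) : Measurable (FF p) := by
  refine Measurable.ite ?_ ((measurable_pi_apply (1 : Fin 3)).pow_const p) measurable_const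
  exact (measurableSet_lt (measurable_pi_apply (1 : Fin 3)) (measurable_pi_apply 0)).inter
    (measurableSet_lt (measurable_pi_apply (1 : Fin 3)) (measurable_pi_apply 2))

lemma measurable_GG (p : ℝ) : Measurable (GG p) := by
  refine Measurable.ite ?_ (((measurable_pi_apply (0 : Fin 3)).pow_const p).mul
    ((measurable_pi_apply (1 : Fin 3)).pow_const p)) measurable_const
  exact (measurableSet_lt (measurable_pi_apply (0 : Fin 3)) (measurable_pi_apply 1)).inter
    (measurableSet_lt (measurable_pi_apply (1 : Fin 3)) (measurable_pi_apply 2))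

lemma rp {x p : ℝ} (h0 : 0 < x) (h1 : x < 1) (hp : 0 < p) : 0 ≤ x ^ p ∧ x ^ p ≤ 1 :=
  ⟨Real.rpow_nonneg h0.le _, Real.rpow_le_one h0.le h1.le hp.le⟩

lemma int_FF {m : ℕ} {p : ℝ} (hp : 0 < p) (τ : Equiv.Perm (Fin 3)) :
    Integrable (fun x => FF p (x ∘ τ)) (law m) := by
  refine int_bdd ((measurable_FF p).comp (measurable_perm τ)) fun x h0 h1 => ?_
  have := rp (h0 (τ 1)) (h1 (τ 1)) hp
  simp only [FF, Function.comp]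
  split_ifs
  · rw [abs_of_nonneg this.1]; exact this.2
  · simp

lemma int_GG {m : ℕ} {p : ℝ} (hp : 0 < p) (τ : Equiv.Perm (Fin 3)) :
    Integrable (fun x => GG p (x ∘ τ)) (law m) := by
  refine int_bdd ((measurable_GG p).comp (measurable_perm τ)) fun x h0 h1 => ?_
  have h := rp (h0 (τ 1)) (h1 (τ 1)) hp
  have h' := rp (h0 (τ 0)) (h1 (τ 0)) hp
  simp only [GG, Function.comp]
  split_ifs
  · rw [abs_of_nonneg (mul_nonneg h'.1 h.1)]; exact mul_le_one₀ h'.2 h.1 h.2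
  · simp

lemma exP : ∀ i j k : Fin 3, i ≠ j → i ≠ k → j ≠ k →
    ∃ τ : Equiv.Perm (Fin 3), τ 0 = i ∧ τ 1 = j ∧ τ 2 = k := by decide

lemma part2 {m : ℕ} {p : ℝ} (hp : 0 < p) :
    ∫ x, (min (x 0) (min (x 1) (x 2))) ^ p ∂(law m) = 3 * ∫ x, FF p x ∂(law m) := by
  obtain ⟨τ0, a0, a1, a2⟩ := exP 0 1 2 (by decide) (by decide) (by decide)
  obtain ⟨τ1, b0, b1, b2⟩ := exP 1 0 2 (by decide) (by decide) (by decide)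
  obtain ⟨τ2, c0, c1, c2⟩ := exP 0 2 1 (by decide) (by decide) (by decide)
  have h : ∫ x, (min (x 0) (min (x 1) (x 2))) ^ p ∂(law m) =
      ∫ x, (FF p (x ∘ τ0) + FF p (x ∘ τ1) + FF p (x ∘ τ2)) ∂(law m) := by
    apply integral_congr_ae
    filter_upwards [law_ties m] with x hx
    have h01 := hx 0 1 (by decide)
    have h02 := hx 0 2 (by decide)
    have h12 := hx 1 2 (by decide)
    simp only [FF, Function.comp, a0, a1, a2, b0, b1, b2, c0, c1, c2]
    rcases lt_or_gt_of_ne h01 with h | h <;> rcases lt_or_gt_of_ne h02 with h' | h' <;>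
      rcases lt_or_gt_of_ne h12 with h'' | h'' <;>
      first
      | (exfalso; linarith)
      | simp [h, h', h'', h.le, h'.le, h''.le, not_lt_of_gt h, not_lt_of_gt h', not_lt_of_gt h'']
  have k1 : Integrable (fun x => FF p (x ∘ τ0) + FF p (x ∘ τ1)) (law m) :=
    (int_FF hp _).add (int_FF hp _)
  rw [h, integral_add k1 (int_FF hp _),
    integral_add (int_FF hp _) (int_FF hp _)]
  simp only [law_int_perm _ (measurable_FF p)]
  ring

lemma part1 {m : ℕ} {α : ℝ} (hα : 0 < α) :
    ∫ x, (min (x 0) (x 1)) ^ α * (min (x 1) (x 2)) ^ α ∂(law m) =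
      ∫ x, FF (2*α) x ∂(law m) + 4 * ∫ x, GG α x ∂(law m) := by
  obtain ⟨τ0, a0, a1, a2⟩ := exP 0 1 2 (by decide) (by decide) (by decide)
  obtain ⟨τ1, b0, b1, b2⟩ := exP 2 1 0 (by decide) (by decide) (by decide)
  obtain ⟨τ2, c0, c1, c2⟩ := exP 0 2 1 (by decide) (by decide) (by decide)
  obtain ⟨τ3, d0, d1, d2⟩ := exP 2 0 1 (by decide) (by decide) (by decide)
  have hp : 0 < 2 * α := by linarith
  have h : ∫ x, (min (x 0) (x 1)) ^ α * (min (x 1) (x 2)) ^ α ∂(law m) =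
      ∫ x, (FF (2*α) (x ∘ τ0) + GG α (x ∘ τ0) + GG α (x ∘ τ1) + GG α (x ∘ τ2)
        + GG α (x ∘ τ3)) ∂(law m) := by
    apply integral_congr_ae
    filter_upwards [law_ties m, law_pos m] with x hx hpos
    have h01 := hx 0 1 (by decide)
    have h02 := hx 0 2 (by decide)
    have h12 := hx 1 2 (by decide)
    have hsq : x 1 ^ α * x 1 ^ α = x 1 ^ (2*α) := by
      rw [← Real.rpow_add (hpos 1)]; congr 1; ring
    simp only [FF, GG, Function.comp, a0, a1, a2, b0, b1, b2, c0, c1, c2, d0, d1, d2]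
    rcases lt_or_gt_of_ne h01 with h | h <;> rcases lt_or_gt_of_ne h02 with h' | h' <;>
      rcases lt_or_gt_of_ne h12 with h'' | h'' <;>
      first
      | (exfalso; linarith)
      | (simp [h, h', h'', h.le, h'.le, h''.le, not_lt_of_gt h, not_lt_of_gt h', not_lt_of_gt h'', hsq]; done)
      | simp [h, h', h'', h.le, h'.le, h''.le, not_lt_of_gt h, not_lt_of_gt h', not_lt_of_gt h'', mul_comm]
  have k1 : Integrable (fun x => FF (2*α) (x ∘ τ0) + GG α (x ∘ τ0)) (law m) :=
    (int_FF hp _).add (int_GG hα _)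
  have k2 : Integrable (fun x => FF (2*α) (x ∘ τ0) + GG α (x ∘ τ0) + GG α (x ∘ τ1)) (law m) :=
    k1.add (int_GG hα _)
  have k3 : Integrable (fun x => FF (2*α) (x ∘ τ0) + GG α (x ∘ τ0) + GG α (x ∘ τ1)
      + GG α (x ∘ τ2)) (law m) := k2.add (int_GG hα _)
  rw [h, integral_add k3 (int_GG hα _), integral_add k2 (int_GG hα _),
    integral_add k1 (int_GG hα _), integral_add (int_FF hp _) (int_GG hα _)]
  simp only [law_int_perm _ (measurable_FF _), law_int_perm _ (measurable_GG _)]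
  ring

lemma beta_int {p : ℝ} (hp : 0 < p) (n : ℕ) :
    ∫ s in (0:ℝ)..1, s ^ (p-1) * (1 - s) ^ n =
      Real.Gamma p * Real.Gamma (n+1) / Real.Gamma (p + (n+1)) := by
  have h := ProbabilityTheory.beta_eq_betaIntegralReal p (n+1) hp (by positivity)
  rw [ProbabilityTheory.beta] at h
  rw [h]
  have : Complex.betaIntegral p ((n+1 : ℝ) : ℂ) =
      ((∫ s in (0:ℝ)..1, s ^ (p-1) * (1 - s) ^ n : ℝ) : ℂ) := by
    rw [← intervalIntegral.integral_ofReal, Complex.betaIntegral]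
    apply intervalIntegral.integral_congr
    intro s hs
    rw [Set.uIcc_of_le zero_le_one] at hs
    simp only
    push_cast
    rw [Complex.ofReal_cpow hs.1]
    push_cast
    rw [add_sub_cancel_right, Complex.cpow_natCast]
  rw [this, Complex.ofReal_re]

lemma part3 {m : ℕ} {p : ℝ} (hp : 0 < p) :
    ∫ x, (min (x 0) (min (x 1) (x 2))) ^ p ∂(law m) =
      (3:ℝ) ^ (-p) * Real.Gamma (1 + p) * Real.Gamma ((m+3:ℕ)+1) /
        Real.Gamma ((m+3:ℕ) + 1 + p) := by
  have hM : Measurable fun x : Fin 3 → ℝ => min (x 0) (min (x 1) (x 2)) :=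
    (measurable_pi_apply _).min ((measurable_pi_apply _).min (measurable_pi_apply _))
  have hnn : 0 ≤ᵐ[law m] fun x : Fin 3 → ℝ => min (x 0) (min (x 1) (x 2)) := by
    filter_upwards [law_pos m] with x hx
    exact le_min (hx 0).le (le_min (hx 1).le (hx 2).le)
  have hg : ∀ t ∈ Set.Ioi (0:ℝ), law m {x | t < min (x 0) (min (x 1) (x 2))} *
      ENNReal.ofReal (t ^ (p-1)) =
      ENNReal.ofReal (max (1 - 3*t) 0 ^ (m+3) * t ^ (p-1)) := by
    intro t ht
    have := law_box (m := m) (fun _ => t) (fun _ => le_of_lt ht)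
    rw [ENNReal.ofReal_mul (by positivity), ENNReal.ofReal_pow (le_max_right _ _)]
    congr 1
    rw [ENNReal.ofReal_max, ENNReal.ofReal_zero, max_eq_left zero_le]
    rw [Fin.sum_univ_three, show 1 - (t + t + t) = 1 - 3 * t by ring] at this
    rw [← this]
    congr 1
    ext x
    simp [Fin.forall_fin_succ]
  rw [integral_eq_lintegral_of_nonneg_ae
    (by filter_upwards [hnn] with x hx using Real.rpow_nonneg hx _)
    (hM.pow_const _).aestronglyMeasurable,
    lintegral_rpow_eq_lintegral_meas_lt_mul _ hnn hM.aemeasurable hp,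
    setLIntegral_congr_fun measurableSet_Ioi hg, ENNReal.toReal_mul,
    ENNReal.toReal_ofReal hp.le, ← integral_eq_lintegral_of_nonneg_ae]
  rotate_left
  · filter_upwards [ae_restrict_mem measurableSet_Ioi] with t ht
    have : (0:ℝ) < t := ht
    simp only [Pi.zero_apply]
    positivity
  · apply Measurable.aestronglyMeasurable
    fun_prop
  have h1 : ∫ t in Set.Ioi (0:ℝ), max (1 - 3*t) 0 ^ (m+3) * t ^ (p-1) =
      ∫ t in Set.Ioi (0:ℝ), (fun s : ℝ => (3:ℝ)^(1-p) * (max (1 - s) 0 ^ (m+3) * s ^ (p-1))) (3*t) := by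
    apply setIntegral_congr_fun measurableSet_Ioi
    intro t ht
    simp only
    rw [Real.mul_rpow (by norm_num) (le_of_lt ht)]
    have : (3:ℝ)^(1-p) * 3^(p-1) = 1 := by
      rw [← Real.rpow_add (by norm_num)]; simp
    linear_combination (-(max (1 - 3*t) 0 ^ (m+3) * t ^ (p-1))) * this
  have h2 : ∫ s in Set.Ioi (0:ℝ), max (1 - s) 0 ^ (m+3) * s ^ (p-1) =
      ∫ s in (0:ℝ)..1, s ^ (p-1) * (1 - s) ^ (m+3) := by
    rw [intervalIntegral.integral_of_le zero_le_one,
      setIntegral_eq_of_subset_of_forall_sdiff_eq_zero (s := Set.Ioc (0:ℝ) 1)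
        (f := fun s : ℝ => max (1 - s) 0 ^ (m+3) * s ^ (p-1)) measurableSet_Ioi
        Set.Ioc_subset_Ioi_self]
    · apply setIntegral_congr_fun measurableSet_Ioc
      intro s hs
      simp only
      rw [max_eq_left (by linarith [hs.2])]; ring
    · rintro s ⟨hs, hs'⟩
      have : 1 < s := by
        by_contra hc
        exact hs' ⟨hs, not_lt.1 hc⟩
      rw [max_eq_right (by linarith)]
      simp
  rw [h1, integral_comp_mul_left_Ioi (fun s : ℝ => (3:ℝ)^(1-p) * (max (1 - s) 0 ^ (m+3) * s ^ (p-1))) _ (by norm_num : (0:ℝ) < 3), mul_zero, integral_const_mul,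
    h2, beta_int hp, add_comm (1:ℝ) p, Real.Gamma_add_one hp.ne',
    show (p + (((m+3:ℕ):ℝ) + 1)) = ((m+3:ℕ):ℝ) + 1 + p by ring,
    show (1 - p : ℝ) = 1 + (-p) by ring, Real.rpow_add (by norm_num), Real.rpow_one, smul_eq_mul]
  ring

/-- Mixed moments of minima of adjacent uniform spacings, for `n ≥ 3` and `α > 0`:
`E[(min{S₁,S₂})^α (min{S₂,S₃})^α]
  = 3^(-1-2α)Γ(1+2α)Γ(n+1)/Γ(n+1+2α) + 4 E[S₁^α S₂^α 1{S₁<S₂<S₃}]`, and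
`E[S₂^(2α) 1{S₂<S₁, S₂<S₃}] = (1/3)E[(min{S₁,S₂,S₃})^(2α)]
  = 3^(-1-2α)Γ(1+2α)Γ(n+1)/Γ(n+1+2α)`. -/
theorem min_adjacent_spacings_moments (n : ℕ) (hn : 3 ≤ n) (α : ℝ) (hα : 0 < α) :
    (∫ u, (min (spacing u 0) (spacing u 1))^α * (min (spacing u 1) (spacing u 2))^α
        ∂(unif n)
      = (3:ℝ)^(-1-2*α) * Real.Gamma (1+2*α) * Real.Gamma ((n:ℝ)+1)
          / Real.Gamma ((n:ℝ)+1+2*α)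
        + 4 * ∫ u, (if spacing u 0 < spacing u 1 ∧ spacing u 1 < spacing u 2
            then (spacing u 0)^α * (spacing u 1)^α else 0) ∂(unif n))
    ∧ (∫ u, (if spacing u 1 < spacing u 0 ∧ spacing u 1 < spacing u 2
          then (spacing u 1)^(2*α) else 0) ∂(unif n)
        = (1/3) * ∫ u, (min (spacing u 0) (min (spacing u 1) (spacing u 2)))^(2*α)
            ∂(unif n))
    ∧ (∫ u, (if spacing u 1 < spacing u 0 ∧ spacing u 1 < spacing u 2
          then (spacing u 1)^(2*α) else 0) ∂(unif n)
        = (3:ℝ)^(-1-2*α) * Real.Gamma (1+2*α) * Real.Gamma ((n:ℝ)+1)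
            / Real.Gamma ((n:ℝ)+1+2*α)) := by
  obtain ⟨m, rfl⟩ := Nat.exists_eq_add_of_le' hn
  have hp : 0 < 2 * α := by linarith
  have t0 : ∀ u : Fin (m+3) → ℝ, spacing u 0 = v3 u 0 := fun u => rfl
  have t1 : ∀ u : Fin (m+3) → ℝ, spacing u 1 = v3 u 1 := fun u => rfl
  have t2 : ∀ u : Fin (m+3) → ℝ, spacing u 2 = v3 u 2 := fun u => rfl
  have hI : ∀ F : (Fin 3 → ℝ) → ℝ, Measurable F →
      ∫ u, F (v3 u) ∂(unif (m+3)) = ∫ x, F x ∂(law m) := fun F hF => by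
    rw [law, integral_map measurable_v3.aemeasurable hF.aestronglyMeasurable]
  have i1 := hI _ (measurable_FF (2*α))
  have i2 := hI _ (measurable_GG α)
  have i3 := hI (fun x => (min (x 0) (min (x 1) (x 2))) ^ (2*α)) (by fun_prop)
  have i4 := hI (fun x => (min (x 0) (x 1)) ^ α * (min (x 1) (x 2)) ^ α) (by fun_prop)
  simp only [FF, GG] at i1 i2
  simp only [t0, t1, t2]
  rw [i1, i2, i3, i4]
  have e1 := part1 (m := m) hα
  have e2 := part2 (m := m) hp
  have e3 := part3 (m := m) hp
  simp only [FF, GG] at e1 e2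
  have e4 : ∫ x : Fin 3 → ℝ, (if x 1 < x 0 ∧ x 1 < x 2 then x 1 ^ (2*α) else 0) ∂(law m) =
      (3:ℝ)^(-1-2*α) * Real.Gamma (1+2*α) * Real.Gamma (((m+3:ℕ):ℝ)+1)
            / Real.Gamma (((m+3:ℕ):ℝ)+1+2*α) := by
    rw [e3] at e2
    rw [show (-1-2*α) = -1 + -(2*α) by ring, Real.rpow_add (by norm_num), Real.rpow_neg_one]
    linear_combination (-1/3) * e2
  refine ⟨?_, ?_, e4⟩
  · rw [e1, e4]
  · rw [e2]; ring
end

section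
/- For n ≥ 1, E[(S_1^n)^α (min{S_1^n, S_2^n})^α] = (1/2)(2^{-2α}Γ(1+2α) + Γ(1+α)^2) · Γ(n+1)/Γ(n+1+2α) for all α > 0. -/
open MeasureTheory

section Aux

open Set ProbabilityTheory

lemma ms_and {X : Type*} [MeasurableSpace X] {p q : X → Prop} (hp : MeasurableSet {x | p x})
    (hq : MeasurableSet {x | q x}) : MeasurableSet {x | p x ∧ q x} := hp.inter hq

lemma beta_facts (a b : ℝ) (ha : 0 < a) (hb : 0 < b) :
    IntegrableOn (fun x : ℝ => x ^ (a - 1) * (1 - x) ^ (b - 1)) (Ioo 0 1) ∧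
    ∫ x in Ioo (0:ℝ) 1, x ^ (a - 1) * (1 - x) ^ (b - 1) =
      Real.Gamma a * Real.Gamma b / Real.Gamma (a + b) := by
  have hB := beta_pos ha hb
  have L := lintegral_betaPDF_eq_one ha hb
  rw [lintegral_betaPDF] at L
  have hnn : 0 ≤ᵐ[volume.restrict (Ioo (0:ℝ) 1)]
      (fun x : ℝ => 1 / beta a b * x ^ (a - 1) * (1 - x) ^ (b - 1)) := by
    filter_upwards [ae_restrict_mem measurableSet_Ioo] with x hx
    have h1 : 0 < x := hx.1
    have h2 : 0 < 1 - x := by linarith [hx.2]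
    simp only [Pi.zero_apply]
    positivity
  have hm : AEStronglyMeasurable (fun x : ℝ => 1 / beta a b * x ^ (a - 1) * (1 - x) ^ (b - 1))
      (volume.restrict (Ioo (0:ℝ) 1)) := by
    apply Measurable.aestronglyMeasurable; fun_prop
  have hI : Integrable (fun x : ℝ => 1 / beta a b * x ^ (a - 1) * (1 - x) ^ (b - 1))
      (volume.restrict (Ioo (0:ℝ) 1)) := by
    refine ⟨hm, ?_⟩
    rw [hasFiniteIntegral_iff_ofReal hnn, L]
    simp
  have hint := integral_eq_lintegral_of_nonneg_ae hnn hm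
  rw [L] at hint
  have he : (fun x : ℝ => x ^ (a - 1) * (1 - x) ^ (b - 1)) =
      fun x => beta a b * (1 / beta a b * x ^ (a - 1) * (1 - x) ^ (b - 1)) := by
    funext x; field_simp
  constructor
  · rw [he]; exact hI.const_mul _
  · rw [he, integral_const_mul, hint]; simp [beta]

lemma lint_beta (a b : ℝ) (ha : 0 < a) (hb : 0 < b) :
    ∫⁻ x in Ioo (0:ℝ) 1, ENNReal.ofReal (x ^ (a - 1) * (1 - x) ^ (b - 1)) =
      ENNReal.ofReal (Real.Gamma a * Real.Gamma b / Real.Gamma (a + b)) := by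
  obtain ⟨h1, h2⟩ := beta_facts a b ha hb
  rw [← h2, ofReal_integral_eq_lintegral_ofReal h1]
  filter_upwards [ae_restrict_mem measurableSet_Ioo] with x hx
  have h1 : 0 < x := hx.1
  have h2 : 0 < 1 - x := by linarith [hx.2]
  simp only [Pi.zero_apply]
  positivity

lemma half_beta (α : ℝ) (hα : 0 < α) :
    ∫⁻ v in Ioo (1/2:ℝ) 1, ENNReal.ofReal (α * (v ^ α * (1 - v) ^ (α - 1))) =
      ENNReal.ofReal (1/2 * ((2:ℝ)^(-2*α) + Real.Gamma (1+α)^2 / Real.Gamma (1+2*α))) := by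
  obtain ⟨h1, h2⟩ := beta_facts (α+1) α (by linarith) hα
  simp only [add_sub_cancel_right] at h1 h2
  set a : ℝ → ℝ := fun v => v ^ α * (1 - v) ^ (α - 1) with ha
  have hI : IntervalIntegrable a volume 0 1 := by
    rw [intervalIntegrable_iff_integrableOn_Ioo_of_le zero_le_one]; exact h1
  have hI1 : IntervalIntegrable a volume 0 (1/2) :=
    hI.mono_set (by rw [uIcc_of_le (by norm_num), uIcc_of_le (by norm_num)]; exact Icc_subset_Icc le_rfl (by norm_num))
  have hI2 : IntervalIntegrable a volume (1/2) 1 :=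
    hI.mono_set (by rw [uIcc_of_le (by norm_num), uIcc_of_le (by norm_num)]; exact Icc_subset_Icc (by norm_num) le_rfl)
  have hsum : (∫ v in (0:ℝ)..(1/2), a v) + (∫ v in (1/2:ℝ)..1, a v) =
      Real.Gamma (α+1) * Real.Gamma α / Real.Gamma (α + 1 + α) := by
    rw [intervalIntegral.integral_add_adjacent_intervals hI1 hI2, intervalIntegral.integral_of_le zero_le_one,
      integral_Ioc_eq_integral_Ioo, h2]
  have hrefl : ∫ v in (1/2:ℝ)..1, a (1 - v) = ∫ v in (0:ℝ)..(1/2), a v := by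
    rw [intervalIntegral.integral_comp_sub_left]; norm_num
  have hI1' : IntervalIntegrable (fun v => a (1 - v)) volume (1/2) 1 := by
    have := (hI1.comp_sub_left 1).symm
    norm_num at this
    simpa using this
  have hftc : ∫ v in (1/2:ℝ)..1, (α * a (1 - v) - α * a v) =
      (fun v : ℝ => v ^ α * (1 - v) ^ α) 1 - (fun v : ℝ => v ^ α * (1 - v) ^ α) (1/2) := by
    refine intervalIntegral.integral_eq_sub_of_hasDerivAt_of_le (a := 1/2) (b := 1)
      (f := fun v : ℝ => v ^ α * (1 - v) ^ α) (f' := fun v => α * a (1 - v) - α * a v) (by norm_num) ?_ ?_ ?_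
    · apply Continuous.continuousOn
      exact (Real.continuous_rpow_const hα.le).mul
        ((Real.continuous_rpow_const hα.le).comp (continuous_const.sub continuous_id))
    · intro x hx
      have hx0 : 0 < x := by linarith [hx.1]
      have hx1 : 0 < 1 - x := by linarith [hx.2]
      have d1 := Real.hasDerivAt_rpow_const (x := x) (p := α) (Or.inl hx0.ne')
      have d2 := (((hasDerivAt_id x).const_sub 1)).rpow_const (p := α) (Or.inl hx1.ne')
      refine (d1.mul d2).congr_deriv ?_
      simp only [ha, id, sub_sub_cancel]
      ring
    · exact (hI1'.const_mul α).sub (hI2.const_mul α)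
  rw [intervalIntegral.integral_sub (hI1'.const_mul α) (hI2.const_mul α),
    intervalIntegral.integral_const_mul, intervalIntegral.integral_const_mul, hrefl] at hftc
  have hval : α * ∫ v in (1/2:ℝ)..1, a v =
      1/2 * ((2:ℝ)^(-2*α) + Real.Gamma (1+α)^2 / Real.Gamma (1+2*α)) := by
    have e1 : ((1/2:ℝ)) ^ α * (1 - 1/2) ^ α = 2 ^ (-2*α) := by
      rw [show (1 - 1/2 : ℝ) = 2⁻¹ by norm_num, show (1/2:ℝ) = 2⁻¹ by norm_num, Real.inv_rpow (by norm_num),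
        ← Real.rpow_neg (by norm_num), ← Real.rpow_add (by norm_num)]
      ring_nf
    have e2 : α * (Real.Gamma (α+1) * Real.Gamma α / Real.Gamma (α + 1 + α)) =
        Real.Gamma (1+α)^2 / Real.Gamma (1+2*α) := by
      rw [show α + 1 + α = 1 + 2*α by ring, add_comm 1 α, sq]
      nth_rewrite 3 [Real.Gamma_add_one hα.ne']
      ring
    simp only [sub_self, Real.zero_rpow hα.ne', mul_zero, e1] at hftc
    rw [← e2, ← hsum]
    linarith
  rw [← hval, intervalIntegral.integral_of_le (by norm_num), integral_Ioc_eq_integral_Ioo,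
    ← integral_const_mul, ofReal_integral_eq_lintegral_ofReal]
  · apply Integrable.const_mul
    rwa [intervalIntegrable_iff_integrableOn_Ioo_of_le (by norm_num)] at hI2
  · filter_upwards [ae_restrict_mem measurableSet_Ioo] with x hx
    have h1 : 0 < x := by linarith [hx.1]
    have h2 : 0 < 1 - x := by linarith [hx.2]
    simp only [Pi.zero_apply, ha]
    positivity

lemma layer (α s : ℝ) (hα : 0 < α) (hs : 0 ≤ s) :
    ∫⁻ t, (if 0 < t ∧ t < s then ENNReal.ofReal (α * t ^ (α - 1)) else 0) = ENNReal.ofReal (s ^ α) := by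
  have : (fun t => (if 0 < t ∧ t < s then ENNReal.ofReal (α * t ^ (α - 1)) else 0)) =
      (Ioo 0 s).indicator (fun t => ENNReal.ofReal (α * t ^ (α - 1))) := by
    funext t; simp [indicator, mem_Ioo]
  rw [this, lintegral_indicator measurableSet_Ioo, ← ofReal_integral_eq_lintegral_ofReal,
    ← integral_Ioc_eq_integral_Ioo, ← intervalIntegral.integral_of_le hs,
    intervalIntegral.integral_const_mul, integral_rpow (Or.inl (by linarith))]
  · simp [Real.zero_rpow hα.ne']; field_simp
  · apply Integrable.const_mul
    have := intervalIntegral.intervalIntegrable_rpow' (a := 0) (b := s) (r := α - 1) (by linarith)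
    rwa [intervalIntegrable_iff_integrableOn_Ioo_of_le hs] at this
  · filter_upwards [ae_restrict_mem measurableSet_Ioo] with x hx
    have h1 : 0 < x := hx.1
    simp only [Pi.zero_apply]
    positivity

lemma lintegral_scale_s17 (r : ℝ) (hr : 0 < r) (h : ℝ → ENNReal) (hh : Measurable h) :
    ∫⁻ x, h x = ENNReal.ofReal r * ∫⁻ v, h (r * v) := by
  have := Real.smul_map_volume_mul_left hr.ne'
  conv_lhs => rw [← this]
  rw [lintegral_smul_measure, lintegral_map hh (by fun_prop), abs_of_pos hr]
  rfl

lemma plane_integral (m : ℕ) (α : ℝ) (hα : 0 < α) :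
    ∫⁻ x, ∫⁻ t, (if 0 < t ∧ t < x ∧ x + t < 1 then
        ENNReal.ofReal (α * t ^ (α - 1) * x ^ α * (1 - x - t) ^ m) else 0) =
      ENNReal.ofReal (Real.Gamma (2*α+1) * Real.Gamma (m+1) / Real.Gamma (2*α+1+(m+1)) *
        (1/2 * ((2:ℝ)^(-2*α) + Real.Gamma (1+α)^2 / Real.Gamma (1+2*α)))) := by
  have step1 : ∀ x : ℝ, ∫⁻ t, (if 0 < t ∧ t < x ∧ x + t < 1 then
        ENNReal.ofReal (α * t ^ (α - 1) * x ^ α * (1 - x - t) ^ m) else 0) =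
      ∫⁻ r, (if 0 < r - x ∧ r - x < x ∧ r < 1 then
        ENNReal.ofReal (α * (r - x) ^ (α - 1) * x ^ α * (1 - r) ^ m) else 0) := by
    intro x
    rw [← lintegral_sub_right_eq_self _ x]
    congr 1; funext r
    rw [show x + (r - x) = r by ring, show 1 - x - (r - x) = 1 - r by ring]
  simp_rw [step1]
  have hms : ∀ r : ℝ, Measurable fun x : ℝ => (if 0 < r - x ∧ r - x < x ∧ r < 1 then
        ENNReal.ofReal (α * (r - x) ^ (α - 1) * x ^ α * (1 - r) ^ m) else 0) := by
    intro r
    refine Measurable.ite ?_ (by fun_prop) (by fun_prop)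
    refine ms_and ?_ (ms_and ?_ (MeasurableSet.const _))
    · exact measurableSet_lt (by fun_prop) (by fun_prop)
    · exact measurableSet_lt (by fun_prop) (by fun_prop)
  rw [lintegral_lintegral_swap]
  swap
  · apply Measurable.aemeasurable
    unfold Function.uncurry
    refine Measurable.ite ?_ (by fun_prop) (by fun_prop)
    refine ms_and ?_ (ms_and ?_ ?_)
    · exact measurableSet_lt (by fun_prop) (by fun_prop)
    · exact measurableSet_lt (by fun_prop) (by fun_prop)
    · exact measurableSet_lt (by fun_prop) (by fun_prop)
  have step2 : ∀ r : ℝ, ∫⁻ x, (if 0 < r - x ∧ r - x < x ∧ r < 1 then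
        ENNReal.ofReal (α * (r - x) ^ (α - 1) * x ^ α * (1 - r) ^ m) else 0) =
      (Ioo (0:ℝ) 1).indicator (fun r => ENNReal.ofReal (r ^ (2*α+1-1) * (1 - r) ^ ((m:ℝ)+1-1)) *
        ENNReal.ofReal (1/2 * ((2:ℝ)^(-2*α) + Real.Gamma (1+α)^2 / Real.Gamma (1+2*α)))) r := by
    intro r
    by_cases hr : r ∈ Ioo (0:ℝ) 1
    · rw [indicator_of_mem hr, ← half_beta α hα, lintegral_scale_s17 r hr.1 _ (hms r),
        ← lintegral_const_mul' _ _ ENNReal.ofReal_ne_top, ← lintegral_const_mul _ (by fun_prop),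
        ← lintegral_indicator measurableSet_Ioo]
      congr 1; funext v
      have hr0 : 0 < r := hr.1
      have hr1 : 0 < 1 - r := by linarith [hr.2]
      by_cases hv : v ∈ Ioo (1/2:ℝ) 1
      · have hv0 : 0 < v := by linarith [hv.1]
        have hv1 : 0 < 1 - v := by linarith [hv.2]
        rw [indicator_of_mem hv, if_pos ⟨by nlinarith, by nlinarith [hv.1], hr.2⟩,
          ← ENNReal.ofReal_mul (by positivity), ← ENNReal.ofReal_mul (by positivity)]
        congr 1
        rw [show r - r * v = r * (1 - v) by ring, Real.mul_rpow hr0.le hv1.le, Real.mul_rpow hr0.le hv0.le,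
          add_sub_cancel_right, add_sub_cancel_right, Real.rpow_natCast,
          show 2 * α = 1 + (α - 1) + α by ring, Real.rpow_add hr0, Real.rpow_add hr0, Real.rpow_one]
        ring
      · rw [indicator_of_notMem hv, if_neg, mul_zero]
        rintro ⟨h1, h2, h3⟩
        apply hv
        constructor
        · nlinarith
        · by_contra hc
          push Not at hc
          nlinarith
    · rw [indicator_of_notMem hr]
      rw [lintegral_eq_zero_iff (hms r)]
      refine Filter.Eventually.of_forall fun x => ?_
      simp only [Pi.zero_apply]
      rw [if_neg]
      rintro ⟨h1, h2, h3⟩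
      exact hr ⟨by linarith, h3⟩
  simp_rw [step2]
  rw [lintegral_indicator measurableSet_Ioo, lintegral_mul_const _ (by fun_prop),
    lint_beta _ _ (by linarith) (by positivity), ← ENNReal.ofReal_mul]
  have := Real.Gamma_pos_of_pos (show 0 < 2*α+1 by linarith)
  have := Real.Gamma_pos_of_pos (show 0 < (m:ℝ)+1 by positivity)
  have := Real.Gamma_pos_of_pos (show 0 < 2*α+1+((m:ℝ)+1) by positivity)
  positivity

lemma ostat_mono {n : ℕ} (u : Fin n → ℝ) : Monotone (ostat u) := Tuple.monotone_sort u

lemma exists_ostat {n : ℕ} (u : Fin n → ℝ) (j : Fin n) : ∃ k, ostat u k = u j ∧ Tuple.sort u k = j :=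
  ⟨(Tuple.sort u).symm j, by simp [ostat], by simp⟩

/-- the i-th spTerm condition -/
def Cond {m : ℕ} (u : Fin (m+1) → ℝ) (t : ℝ) (i : Fin (m+1)) : Prop :=
  0 < t ∧ t < u i ∧ u i + t < 1 ∧ ∀ j, u i + t < u (i.succAbove j)

lemma cond_ne {m : ℕ} {u : Fin (m+1) → ℝ} {t : ℝ} {i : Fin (m+1)} (h : Cond u t i) (j : Fin (m+1))
    (hj : j ≠ i) : u i + t < u j := by
  obtain ⟨k, rfl⟩ := Fin.exists_succAbove_eq hj
  exact h.2.2.2 k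

lemma cond_unique {m : ℕ} {u : Fin (m+1) → ℝ} {t : ℝ} {i j : Fin (m+1)} (h : Cond u t i) (h' : Cond u t j) :
    j = i := by
  by_contra hne
  have h1 := cond_ne h j hne
  have h2 := cond_ne h' i (Ne.symm hne)
  linarith [h.1]

lemma spacing_zero {m : ℕ} (u : Fin (m+1) → ℝ) : spacing u 0 = ostat u 0 := by
  simp [spacing]

lemma spacing_one {m : ℕ} (u : Fin (m+1) → ℝ) : spacing u 1 =
    (if h : 1 < m+1 then ostat u ⟨1, h⟩ else 1) - ostat u 0 := by
  have : ((1 : Fin (m+1+1)) : ℕ) = 1 := by simp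
  simp [spacing]

lemma cond_imp {m : ℕ} {u : Fin (m+1) → ℝ} {t : ℝ} {i : Fin (m+1)} (h : Cond u t i) :
    spacing u 0 = u i ∧ t < spacing u 0 ∧ t < spacing u 1 := by
  have h0 : Tuple.sort u 0 = i := by
    by_contra hne
    have h1 := cond_ne h _ hne
    obtain ⟨k, hk, -⟩ := exists_ostat u i
    have h2 := ostat_mono u (Fin.zero_le k)
    rw [hk] at h2
    have : ostat u 0 = u (Tuple.sort u 0) := rfl
    linarith [h.1]
  have hs : ostat u 0 = u i := by rw [← h0]; rfl
  rw [spacing_zero, spacing_one, hs]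
  refine ⟨rfl, h.2.1, ?_⟩
  split_ifs with hm
  · have : Tuple.sort u ⟨1, hm⟩ ≠ i := by
      rw [← h0]; intro hc
      have := (Tuple.sort u).injective hc
      simp [Fin.ext_iff] at this
    have h1 := cond_ne h _ this
    have : ostat u ⟨1, hm⟩ = u (Tuple.sort u ⟨1, hm⟩) := rfl
    linarith
  · linarith [h.2.2.1]

lemma imp_cond {m : ℕ} {u : Fin (m+1) → ℝ} (hu : ∀ i, u i ∈ Ioo (0:ℝ) 1) {t : ℝ} (ht : 0 < t)
    (h0 : t < spacing u 0) (h1 : t < spacing u 1) : Cond u t (Tuple.sort u 0) := by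
  rw [spacing_zero] at h0
  rw [spacing_one] at h1
  have hs : ostat u 0 = u (Tuple.sort u 0) := rfl
  rw [hs] at h0 h1
  refine ⟨ht, h0, ?_, ?_⟩
  · split_ifs at h1 with hm
    · have : ostat u ⟨1, hm⟩ < 1 := (hu _).2
      linarith
    · linarith
  · intro j
    obtain ⟨k, hk, hk'⟩ := exists_ostat u ((Tuple.sort u 0).succAbove j)
    have hk0 : k ≠ 0 := by
      rintro rfl
      exact Fin.succAbove_ne _ _ hk'.symm
    have hkk : 0 < (k : ℕ) := Nat.pos_of_ne_zero (fun h => hk0 (Fin.ext h))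
    have hm : 1 < m + 1 := by have := k.isLt; omega
    rw [dif_pos hm] at h1
    have : ostat u ⟨1, hm⟩ ≤ ostat u k := ostat_mono u (by rw [Fin.le_def]; exact hkk)
    rw [hk] at this
    linarith

open Classical in
/-- i-th spTerm -/
noncomputable def spTerm {m : ℕ} (α : ℝ) (i : Fin (m+1)) (u : Fin (m+1) → ℝ) (t : ℝ) : ENNReal :=
  if Cond u t i then ENNReal.ofReal (α * t ^ (α - 1) * u i ^ α) else 0

lemma spTerm_measurable {m : ℕ} (α : ℝ) (i : Fin (m+1)) :
    Measurable (Function.uncurry (spTerm (m := m) α i)) := by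
  unfold Function.uncurry spTerm
  refine Measurable.ite ?_ (by fun_prop) (by fun_prop)
  unfold Cond
  refine ms_and ?_ (ms_and ?_ (ms_and ?_ ?_))
  · exact measurableSet_lt (by fun_prop) (by fun_prop)
  · exact measurableSet_lt (by fun_prop) (by fun_prop)
  · exact measurableSet_lt (by fun_prop) (by fun_prop)
  simp only [ofPred_forall]
  exact MeasurableSet.iInter fun j => measurableSet_lt (by fun_prop) (by fun_prop)

lemma spacing_nonneg {m : ℕ} {u : Fin (m+1) → ℝ} (hu : ∀ i, u i ∈ Ioo (0:ℝ) 1) :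
    0 ≤ spacing u 0 ∧ 0 ≤ spacing u 1 := by
  rw [spacing_zero, spacing_one]
  refine ⟨(hu _).1.le, ?_⟩
  split_ifs with hm
  · have := ostat_mono u (Fin.zero_le ⟨1, hm⟩)
    linarith
  · have : ostat u 0 < 1 := (hu _).2
    linarith

lemma pointwise {m : ℕ} (α : ℝ) (hα : 0 < α) {u : Fin (m+1) → ℝ} (hu : ∀ i, u i ∈ Ioo (0:ℝ) 1) :
    ENNReal.ofReal ((spacing u 0)^α * (min (spacing u 0) (spacing u 1))^α) =
      ∫⁻ t, ∑ i, spTerm α i u t := by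
  obtain ⟨n0, n1⟩ := spacing_nonneg hu
  rw [ENNReal.ofReal_mul (by positivity), ← layer α _ hα (le_min n0 n1), ← lintegral_const_mul']
  swap
  · simp
  congr 1; funext t
  by_cases h : 0 < t ∧ t < min (spacing u 0) (spacing u 1)
  · rw [if_pos h]
    obtain ⟨ht, hmin⟩ := h
    rw [lt_min_iff] at hmin
    have hc := imp_cond hu ht hmin.1 hmin.2
    rw [Finset.sum_eq_single (Tuple.sort u 0)]
    · rw [spTerm, if_pos hc, ← ENNReal.ofReal_mul (by positivity), (cond_imp hc).1, mul_comm]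
    · intro j _ hj
      rw [spTerm, if_neg]
      intro h'
      exact hj (cond_unique hc h')
    · simp
  · rw [if_neg h, mul_zero, Finset.sum_eq_zero]
    intro i _
    rw [spTerm, if_neg]
    intro h'
    exact h ⟨h'.1, lt_min (cond_imp h').2.1 (cond_imp h').2.2⟩

lemma fiber {m : ℕ} (c : ℝ) (hc : 0 < c) :
    (unif m) {y | ∀ j, c < y j} = ENNReal.ofReal (1 - c) ^ m := by
  have : {y : Fin m → ℝ | ∀ j, c < y j} = Set.univ.pi fun _ => Ioi c := by
    ext y; simp
  rw [this, unif, Measure.pi_pi]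
  simp only [Measure.restrict_apply measurableSet_Ioi, Ioi_inter_Ioo, sup_eq_left.2 hc.le, Real.volume_Ioo]
  simp

lemma spTerm_integral {m : ℕ} (α : ℝ) (hα : 0 < α) (i : Fin (m+1)) (t : ℝ) :
    ∫⁻ u, spTerm α i u t ∂(unif (m+1)) =
      ∫⁻ x, (if 0 < t ∧ t < x ∧ x + t < 1 then
        ENNReal.ofReal (α * t ^ (α - 1) * x ^ α * (1 - x - t) ^ m) else 0) := by
  have hmp := (measurePreserving_piFinSuccAbove (fun _ : Fin (m+1) => volume.restrict (Ioo (0:ℝ) 1)) i).symm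
  have hmt : Measurable fun u : Fin (m+1) → ℝ => spTerm α i u t :=
    (spTerm_measurable α i).comp (measurable_id.prodMk measurable_const)
  unfold unif
  rw [← hmp.lintegral_comp hmt, lintegral_prod (fun a => spTerm α i
      ((MeasurableEquiv.piFinSuccAbove (fun _ => ℝ) i).symm a) t) (hmt.comp (MeasurableEquiv.measurable _)).aemeasurable,
    ← lintegral_indicator measurableSet_Ioo]
  congr 1; funext x
  by_cases hc : 0 < t ∧ t < x ∧ x + t < 1
  · obtain ⟨h1, h2, h3⟩ := hc
    rw [if_pos ⟨h1, h2, h3⟩, indicator_of_mem (show x ∈ Ioo (0:ℝ) 1 from ⟨by linarith, by linarith⟩)]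
    have hx : 0 < x := by linarith
    have hms : MeasurableSet {y : Fin m → ℝ | ∀ j, x + t < y j} := by
      simp only [ofPred_forall]
      exact MeasurableSet.iInter fun j => measurableSet_lt (by fun_prop) (by fun_prop)
    have : ∀ y : Fin m → ℝ, spTerm α i ((MeasurableEquiv.piFinSuccAbove (fun _ => ℝ) i).symm (x, y)) t =
        {y : Fin m → ℝ | ∀ j, x + t < y j}.indicator (fun _ => ENNReal.ofReal (α * t ^ (α - 1) * x ^ α)) y := by
      intro y
      simp [spTerm, Cond, indicator, MeasurableEquiv.piFinSuccAbove_symm_apply, Fin.insertNthEquiv, h1, h2, h3]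
    simp_rw [this]
    rw [lintegral_indicator_const hms]
    have hf := fiber (m := m) (x + t) (by linarith)
    unfold unif at hf
    rw [hf, ← ENNReal.ofReal_pow (by linarith), ← ENNReal.ofReal_mul (by positivity),
      show 1 - (x + t) = 1 - x - t by ring]
  · rw [if_neg hc]
    have : ∀ y : Fin m → ℝ, spTerm α i ((MeasurableEquiv.piFinSuccAbove (fun _ => ℝ) i).symm (x, y)) t = 0 := by
      intro y
      rw [spTerm, if_neg]
      intro h
      apply hc
      have := h.1
      have h2 := h.2.1
      have h3 := h.2.2.1
      simp [MeasurableEquiv.piFinSuccAbove_symm_apply, Fin.insertNthEquiv] at h2 h3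
      exact ⟨this, h2, h3⟩
    exact indicator_apply_eq_zero.2 fun _ => (lintegral_congr this).trans lintegral_zero

lemma ae_cube (n : ℕ) : ∀ᵐ u ∂(unif n), ∀ i, u i ∈ Ioo (0:ℝ) 1 := by
  rw [ae_all_iff]
  intro i
  exact Measure.tendsto_eval_ae_ae.eventually (ae_restrict_mem (μ := volume) measurableSet_Ioo)

lemma main_succ (m : ℕ) (α : ℝ) (hα : 0 < α) :
    ∫ u, (spacing u 0)^α * (min (spacing u 0) (spacing u 1))^α ∂(unif (m+1)) =
      (m+1) * (Real.Gamma (2*α+1) * Real.Gamma (m+1) / Real.Gamma (2*α+1+(m+1)) *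
        (1/2 * ((2:ℝ)^(-2*α) + Real.Gamma (1+α)^2 / Real.Gamma (1+2*α)))) := by
  have : IsProbabilityMeasure (volume.restrict (Ioo (0:ℝ) 1)) := ⟨by simp⟩
  have : SFinite (unif (m+1)) := by unfold unif; infer_instance
  have hK : Measurable fun p : (Fin (m+1) → ℝ) × ℝ => ∑ i, spTerm α i p.1 p.2 :=
    Finset.measurable_sum _ fun i _ => spTerm_measurable α i
  have hK' : Measurable fun u : Fin (m+1) → ℝ => ∫⁻ t, ∑ i, spTerm α i u t := hK.lintegral_prod_right'
  have e1 : ∫ u, (spacing u 0)^α * (min (spacing u 0) (spacing u 1))^α ∂(unif (m+1)) =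
      ∫ u, (∫⁻ t, ∑ i, spTerm α i u t).toReal ∂(unif (m+1)) := by
    apply integral_congr_ae
    filter_upwards [ae_cube (m+1)] with u hu
    obtain ⟨n0, n1⟩ := spacing_nonneg hu
    have := le_min n0 n1
    rw [← pointwise α hα hu, ENNReal.toReal_ofReal (by positivity)]
  rw [e1, integral_toReal hK'.aemeasurable, lintegral_lintegral_swap hK.aemeasurable]
  swap
  · filter_upwards [ae_cube (m+1)] with u hu
    rw [← pointwise α hα hu]
    exact ENNReal.ofReal_lt_top
  have e2 : ∀ t, ∫⁻ u, ∑ i, spTerm α i u t ∂(unif (m+1)) =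
      (m+1 : ENNReal) * ∫⁻ x, (if 0 < t ∧ t < x ∧ x + t < 1 then
        ENNReal.ofReal (α * t ^ (α - 1) * x ^ α * (1 - x - t) ^ m) else 0) := by
    intro t
    rw [lintegral_finsetSum]
    · simp_rw [spTerm_integral α hα]
      simp
    · intro i _
      exact (spTerm_measurable α i).comp (measurable_id.prodMk measurable_const)
  have hmeas : Measurable fun p : ℝ × ℝ => (if 0 < p.1 ∧ p.1 < p.2 ∧ p.2 + p.1 < 1 then
        ENNReal.ofReal (α * p.1 ^ (α - 1) * p.2 ^ α * (1 - p.2 - p.1) ^ m) else 0) := by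
    refine Measurable.ite ?_ (by fun_prop) (by fun_prop)
    refine ms_and ?_ (ms_and ?_ ?_)
    · exact measurableSet_lt (by fun_prop) (by fun_prop)
    · exact measurableSet_lt (by fun_prop) (by fun_prop)
    · exact measurableSet_lt (by fun_prop) (by fun_prop)
  simp_rw [e2]
  rw [lintegral_const_mul _ hmeas.lintegral_prod_right', lintegral_lintegral_swap hmeas.aemeasurable,
    plane_integral m α hα, ENNReal.toReal_mul, ENNReal.toReal_ofReal]
  · congr 1
  have := Real.Gamma_pos_of_pos (show 0 < 2*α+1 by linarith)
  have := Real.Gamma_pos_of_pos (show 0 < (m:ℝ)+1 by positivity)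
  have := Real.Gamma_pos_of_pos (show 0 < 2*α+1+((m:ℝ)+1) by positivity)
  have := Real.Gamma_pos_of_pos (show 0 < 1+2*α by linarith)
  positivity

end Aux

/-- For `n ≥ 1` and `α > 0`:
`E[(S₁ⁿ)^α (min{S₁ⁿ, S₂ⁿ})^α]
  = (1/2)(2^(-2α)Γ(1+2α) + Γ(1+α)²)·Γ(n+1)/Γ(n+1+2α)`. -/
theorem spacing_times_min_moment (n : ℕ) (hn : 1 ≤ n) (α : ℝ) (hα : 0 < α) :
    ∫ u, (spacing u 0)^α * (min (spacing u 0) (spacing u 1))^α ∂(unif n)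
      = (1/2) * ((2:ℝ)^(-2*α) * Real.Gamma (1+2*α) + Real.Gamma (1+α)^2)
          * Real.Gamma ((n:ℝ)+1) / Real.Gamma ((n:ℝ)+1+2*α) := by
  obtain ⟨m, rfl⟩ : ∃ m, n = m + 1 := ⟨n - 1, by omega⟩
  rw [main_succ m α hα]
  have g := Real.Gamma_pos_of_pos (show 0 < 1+2*α by linarith)
  have h1 : Real.Gamma (((m+1 : ℕ) : ℝ) + 1) = (m+1) * Real.Gamma (m+1) := by
    push_cast
    exact Real.Gamma_add_one (by positivity)
  rw [h1, show ((m+1 : ℕ) : ℝ) + 1 + 2*α = 2*α+1+(m+1) by push_cast; ring, add_comm (2*α) 1]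
  have g2 := Real.Gamma_pos_of_pos (show 0 < 1+2*α+((m:ℝ)+1) by positivity)
  field_simp
end
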